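/- Fix an integer N ≥ 1, reals p > 1, R > 0, and α, γ with γ − α ≥ 0, a continuous function a : [0,R] → ℝ with a(r) > 0 for all r, set β := (2+γ−α)/(p−1), and assume β + 1 − α > 0 and (3+N)β ≥ 2α; set K := (β(β+1−α)/a(R))^{1/(p−1)}. Then for each ε ∈ (0,1) there exists a positive function ψ_ε : (0,R) → ℝ, twice differentiable on (0,R) and continuously differentiable up to 0 with ψ_ε′(0) = 0, such that ψ_ε″(r) + ((N−1)/r − α/(R−r)) ψ_ε′(r) = a(r)(R−r)^{γ−α} ψ_ε(r)^p for all r ∈ (0,R), ψ_ε(r) → ∞ as r → R⁻, and 1−ε ≤ liminf_{r→R⁻} ψ_ε(r)/(K(R−r)^{−β}) ≤ limsup_{r→R⁻} ψ_ε(r)/(K(R−r)^{−β}) ≤ 1+ε. -/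

import Mathlib

open Set Filter

section
open MeasureTheory ENNReal

/-- The monotone integral operator of the radial initial value problem. -/
noncomputable def radT (wi q : ℝ → ℝ≥0∞) (p : ℝ) (u : ℝ → ℝ≥0∞) (r : ℝ) : ℝ≥0∞ :=
  ∫⁻ s in Ioo 0 r, wi s * ∫⁻ t in Ioo 0 s, q t * u t ^ p

lemma radT_mono (wi q : ℝ → ℝ≥0∞) {p : ℝ} (hp : 0 ≤ p) {u v : ℝ → ℝ≥0∞} (h : u ≤ v) :
    radT wi q p u ≤ radT wi q p v := by
  intro r
  unfold radT
  gcongr with s t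
  exact h t

lemma inner_monotone (q : ℝ → ℝ≥0∞) (p : ℝ) (u : ℝ → ℝ≥0∞) :
    Monotone (fun s : ℝ => ∫⁻ t in Ioo 0 s, q t * u t ^ p) := by
  intro a b hab
  exact lintegral_mono_set (Ioo_subset_Ioo_right hab)

lemma radT_monotone (wi q : ℝ → ℝ≥0∞) (p : ℝ) (u : ℝ → ℝ≥0∞) : Monotone (radT wi q p u) := by
  intro a b hab
  exact lintegral_mono_set (Ioo_subset_Ioo_right hab)

lemma radT_zero (wi q : ℝ → ℝ≥0∞) {p : ℝ} (hp : 0 < p) (r : ℝ) :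
    radT wi q p (fun _ => 0) r = 0 := by
  simp [radT, ENNReal.zero_rpow_of_pos hp]

lemma radT_iSup (wi q : ℝ → ℝ≥0∞) (hwi : Measurable wi) (hq : Measurable q) {p : ℝ} (hp : 0 < p)
    (u : ℕ → ℝ → ℝ≥0∞) (hu : ∀ n, Measurable (u n)) (hmono : Monotone u) (r : ℝ) :
    radT wi q p (fun x => ⨆ n, u n x) r = ⨆ n, radT wi q p (u n) r := by
  unfold radT
  have h1 : ∀ t, q t * (⨆ n, u n t) ^ p = ⨆ n, q t * u n t ^ p := by
    intro t
    rw [← ENNReal.mul_iSup]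
    congr 1
    exact (ENNReal.orderIsoRpow p hp).map_iSup (fun n => u n t)
  have h2 : ∀ s : ℝ, wi s * ∫⁻ t in Ioo 0 s, q t * (⨆ n, u n t) ^ p
      = ⨆ n, wi s * ∫⁻ t in Ioo 0 s, q t * u n t ^ p := by
    intro s
    rw [← ENNReal.mul_iSup]
    congr 1
    simp_rw [h1]
    rw [lintegral_iSup]
    · intro n
      exact hq.mul ((hu n).pow_const p)
    · intro m n hmn t
      show q t * u m t ^ p ≤ q t * u n t ^ p
      have := hmono hmn t
      gcongr
  simp_rw [h2]
  rw [lintegral_iSup]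
  · intro n
    exact hwi.mul (inner_monotone q p (u n)).measurable
  · intro m n hmn s
    show wi s * _ ≤ wi s * _
    gcongr with t
    exact hmono hmn t

lemma exists_critical (wi q : ℝ → ℝ≥0∞) (hwi : Measurable wi) (hq : Measurable q) {p : ℝ}
    (hp : 0 < p) (U : ℝ → ℝ≥0∞) {R : ℝ} (hR : 0 < R) (hU0 : U 0 ≠ ⊤) :
    ∃ (c : ℝ≥0∞) (ψ : ℝ → ℝ≥0∞), c ≠ ⊤ ∧ (∀ r, ψ r = c + radT wi q p ψ r) ∧
      (∀ r ∈ Ico 0 R, ψ r ≤ U r) ∧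
      (∀ δ : ℝ≥0∞, δ ≠ 0 → ∀ h : ℝ → ℝ≥0∞, (∀ r, c + δ + radT wi q p h r ≤ h r) →
        ∃ r ∈ Ico 0 R, U r < h r) ∧
      (c = 0 → ∀ r, ψ r = 0) := by
  have hsol : ∀ c : ℝ≥0∞, ∃ u : ℝ → ℝ≥0∞, (∀ r, u r = c + radT wi q p u r) ∧
      ∀ h : ℝ → ℝ≥0∞, (∀ r, c + radT wi q p h r ≤ h r) → u ≤ h := by
    intro c
    let f : (ℝ → ℝ≥0∞) →o (ℝ → ℝ≥0∞) :=
      ⟨fun u r => c + radT wi q p u r, fun u v huv r => by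
        have := radT_mono wi q hp.le huv r
        show c + _ ≤ c + _
        gcongr⟩
    refine ⟨f.lfp, fun r => ?_, fun h hh => f.lfp_le hh⟩
    exact (congrFun f.map_lfp r).symm
  choose u hu hmin using hsol
  have humono : Monotone u := by
    intro c d hcd
    apply hmin
    intro r
    calc c + radT wi q p (u d) r ≤ d + radT wi q p (u d) r := by gcongr
      _ = u d r := (hu d r).symm
  have hum : ∀ c, Measurable (u c) := by
    intro c
    have : u c = fun r => c + radT wi q p (u c) r := funext (hu c)
    rw [this]
    exact (measurable_const.add (radT_monotone wi q p (u c)).measurable)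
  let G : Set ℝ≥0∞ := {c | ∀ r ∈ Ico 0 R, u c r ≤ U r}
  have hu0 : ∀ r, u 0 r = 0 := by
    intro r
    have := hmin 0 (fun _ => 0) (fun r => by rw [radT_zero _ _ hp]; simp) r
    simpa using this
  have hG : G.Nonempty := ⟨0, fun r _ => by rw [hu0]; exact zero_le⟩
  obtain ⟨cs, hcm, hct, hcG⟩ := exists_seq_tendsto_sSup hG (OrderTop.bddAbove G)
  have hsup : ⨆ n, cs n = sSup G := iSup_eq_of_tendsto hcm hct
  have hle : sSup G ≤ U 0 := by
    apply sSup_le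
    intro c hc
    refine le_trans ?_ (hc 0 ⟨le_rfl, hR⟩)
    rw [hu c 0]
    exact le_self_add
  refine ⟨sSup G, fun r => ⨆ n, u (cs n) r, ?_, ?_, ?_, ?_, ?_⟩
  · exact ne_top_of_le_ne_top hU0 hle
  · intro r
    rw [radT_iSup wi q hwi hq hp (fun n => u (cs n)) (fun n => hum _) (humono.comp hcm), ← hsup,
      ENNReal.iSup_add_iSup_of_monotone hcm]
    · exact iSup_congr fun n => hu _ r
    · intro m n hmn
      exact radT_mono wi q hp.le (humono (hcm hmn)) r
  · intro r hr
    exact iSup_le fun n => hcG n r hr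
  · intro δ hδ h hh
    by_contra! hcon
    have hmem : sSup G + δ ∈ G := fun r hr => (hmin _ h hh r).trans (hcon r hr)
    have h1 : sSup G + δ ≤ sSup G := le_sSup hmem
    have h2 : sSup G < sSup G + δ :=
      ENNReal.lt_add_right (ne_top_of_le_ne_top hU0 hle) hδ
    exact absurd h1 (not_le.mpr h2)
  · intro hc r
    have : ∀ n, cs n = 0 := by
      intro n
      have := le_sSup (hcG n)
      rw [hc] at this
      simpa using this
    simp [this, hu0]

end

open Set Filter

section
open MeasureTheory ENNReal

lemma lintegral_Ioo_ofReal {f : ℝ → ℝ} {a b : ℝ} (hab : a ≤ b)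
    (hi : IntervalIntegrable f volume a b) (hf : ∀ x ∈ Ioo a b, 0 ≤ f x) :
    ∫⁻ x in Ioo a b, ENNReal.ofReal (f x) = ENNReal.ofReal (∫ x in a..b, f x) := by
  rw [intervalIntegral.integral_of_le hab, integral_Ioc_eq_integral_Ioo,
    ofReal_integral_eq_lintegral_ofReal]
  · exact ((intervalIntegrable_iff_integrableOn_Ioo_of_le hab).1 hi)
  · exact (ae_restrict_iff' measurableSet_Ioo).2 (Eventually.of_forall hf)

lemma lintegral_Ioo_deriv {P P' : ℝ → ℝ} {a b : ℝ} (hab : a ≤ b) (hc : ContinuousOn P (Icc a b))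
    (hd : ∀ x ∈ Ioo a b, HasDerivAt P (P' x) x) (hn : ∀ x ∈ Ioo a b, 0 ≤ P' x) :
    ∫⁻ x in Ioo a b, ENNReal.ofReal (P' x) = ENNReal.ofReal (P b - P a) := by
  have hi : IntervalIntegrable P' volume a b :=
    (intervalIntegrable_iff_integrableOn_Ioc_of_le hab).2
      (intervalIntegral.integrableOn_deriv_of_nonneg hc hd hn)
  rw [lintegral_Ioo_ofReal hab hi hn,
    intervalIntegral.integral_eq_sub_of_hasDerivAt_of_le hab hc hd hi]

lemma primitive_facts {f : ℝ → ℝ} {R : ℝ} (hi : ∀ r ∈ Ioo 0 R, IntervalIntegrable f volume 0 r) :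
    ContinuousOn (fun r => ∫ t in (0 : ℝ)..r, f t) (Ico 0 R) := by
  intro r hr
  obtain ⟨r', h1, h2⟩ := exists_between hr.2
  have hr' : 0 < r' := hr.1.trans_lt h1
  have := intervalIntegral.continuousOn_primitive_interval' (hi r' ⟨hr', h2⟩) left_mem_uIcc
  rw [uIcc_of_le hr'.le] at this
  refine (this r ⟨hr.1, h1.le⟩).mono_of_mem_nhdsWithin ?_
  refine mem_nhdsWithin.2 ⟨Iio r', isOpen_Iio, h1, ?_⟩
  rintro y ⟨hy1, hy2⟩
  exact ⟨hy2.1, le_of_lt hy1⟩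

lemma primitive_deriv {f : ℝ → ℝ} {R : ℝ} (hi : ∀ r ∈ Ioo 0 R, IntervalIntegrable f volume 0 r)
    (hc : ContinuousOn f (Ioo 0 R)) (r : ℝ) (hr : r ∈ Ioo 0 R) :
    HasDerivAt (fun r => ∫ t in (0 : ℝ)..r, f t) (f r) r :=
  intervalIntegral.integral_hasDerivAt_right (hi r hr)
    (hc.stronglyMeasurableAtFilter isOpen_Ioo r hr) (hc.continuousAt (isOpen_Ioo.mem_nhds hr))

lemma real_extract {w b : ℝ → ℝ} {R p : ℝ} (hp : 1 < p)
    (hwm : Measurable w) (hbm : Measurable b) (hwpos : ∀ r ∈ Ioo 0 R, 0 < w r)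
    (hwc : ContinuousOn w (Ico 0 R)) (hbc : ContinuousOn b (Ico 0 R))
    (hb : ∀ r ∈ Ico 0 R, 0 < b r)
    (hwC : ∀ ρ ∈ Ioo 0 R, ∃ C > 0, ∀ s ∈ Ioc 0 ρ, ∀ t ∈ Ioc 0 s, w t ≤ C * w s)
    {c : ℝ≥0∞} {ψ : ℝ → ℝ≥0∞}
    (hψ : ∀ r, ψ r = c + radT (fun s => ENNReal.ofReal (w s)⁻¹)
      (fun t => ENNReal.ofReal (w t * b t)) p ψ r)
    (hfin : ∀ r ∈ Ico 0 R, ψ r ≠ ⊤) (hR : 0 < R) :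
    ∃ x Φ : ℝ → ℝ, (∀ r ∈ Ico 0 R, ψ r = ENNReal.ofReal (x r)) ∧ (∀ r, 0 ≤ x r) ∧
      x 0 = c.toReal ∧ Monotone (fun r => ψ r) ∧ ContinuousOn x (Ico 0 R) ∧
      ContinuousOn Φ (Ico 0 R) ∧ Φ 0 = 0 ∧ (∀ r ∈ Ico 0 R, 0 ≤ Φ r) ∧
      (∀ r ∈ Ioo 0 R, HasDerivAt x (Φ r / w r) r) ∧
      (∀ r ∈ Ioo 0 R, HasDerivAt Φ (w r * b r * x r ^ p) r) ∧
      (∀ ρ ∈ Ioo 0 R, ∃ M, ∀ s ∈ Ioc 0 ρ, Φ s ≤ M * s * w s) := by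
  have hmono : Monotone ψ := by
    intro r r' h
    rw [hψ r, hψ r']
    have := radT_monotone (fun s => ENNReal.ofReal (w s)⁻¹)
      (fun t => ENNReal.ofReal (w t * b t)) p ψ h
    gcongr
  set x : ℝ → ℝ := fun r => (ψ r).toReal with hx
  have hxψ : ∀ r ∈ Ico 0 R, ψ r = ENNReal.ofReal (x r) := fun r hr =>
    (ENNReal.ofReal_toReal (hfin r hr)).symm
  have hx0 : ∀ r, 0 ≤ x r := fun r => ENNReal.toReal_nonneg
  have hxmono : ∀ s ∈ Ico 0 R, ∀ t ≤ s, x t ≤ x s := fun s hs t hts =>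
    ENNReal.toReal_mono (hfin s hs) (hmono hts)
  have hxm : Measurable x := hmono.measurable.ennreal_toReal
  set F : ℝ → ℝ := fun t => w t * b t * x t ^ p with hF
  have hFm : Measurable F := (hwm.mul hbm).mul (hxm.pow_const p)
  have hF0 : ∀ t ∈ Ioo 0 R, 0 ≤ F t := fun t ht =>
    mul_nonneg (mul_nonneg (hwpos t ht).le (hb t ⟨ht.1.le, ht.2⟩).le) (Real.rpow_nonneg (hx0 t) p)
  -- bounds for F
  have hFb : ∀ ρ ∈ Ioo 0 R, ∃ M ≥ 0, ∀ s ∈ Ioc 0 ρ, ∀ t ∈ Ioc 0 s, F t ≤ M * w s := by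
    intro ρ hρ
    obtain ⟨C, hC, hCw⟩ := hwC ρ hρ
    obtain ⟨B, hB⟩ := (isCompact_Icc (a := 0) (b := ρ)).bddAbove_image
      (hbc.mono (Icc_subset_Ico_right hρ.2))
    have hB' : ∀ t ∈ Icc 0 ρ, b t ≤ B := fun t ht => hB (mem_image_of_mem b ht)
    have hB0 : 0 ≤ B := (hb 0 ⟨le_rfl, hR⟩).le.trans (hB' 0 ⟨le_rfl, hρ.1.le⟩)
    refine ⟨C * B * x ρ ^ p, by have := hx0 ρ; positivity, ?_⟩
    intro s hs t ht
    have htρ : t ≤ ρ := ht.2.trans hs.2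
    have h1 := hCw s hs t ht
    have h2 := hB' t ⟨ht.1.le, htρ⟩
    have h3 : x t ^ p ≤ x ρ ^ p :=
      Real.rpow_le_rpow (hx0 t) (hxmono ρ ⟨hρ.1.le, hρ.2⟩ t htρ) (by linarith)
    have hws := hwpos s ⟨hs.1, hs.2.trans_lt hρ.2⟩
    have hbt := hb t ⟨ht.1.le, htρ.trans_lt hρ.2⟩
    calc F t = w t * b t * x t ^ p := rfl
      _ ≤ (C * w s) * B * x ρ ^ p := by
        have := hx0 t
        gcongr
      _ = _ := by ring
  have hFi : ∀ r ∈ Ioo 0 R, IntervalIntegrable F volume 0 r := by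
    intro r hr
    rw [intervalIntegrable_iff_integrableOn_Ioc_of_le hr.1.le]
    obtain ⟨M, hM0, hM⟩ := hFb r hr
    refine Measure.integrableOn_of_bounded (M := M * w r) measure_Ioc_lt_top.ne
      hFm.aestronglyMeasurable ?_
    refine (ae_restrict_iff' measurableSet_Ioc).2 (Eventually.of_forall fun t ht => ?_)
    rw [Real.norm_of_nonneg (hF0 t ⟨ht.1, ht.2.trans_lt hr.2⟩)]
    exact hM r ⟨hr.1, le_rfl⟩ t ht
  set Φ : ℝ → ℝ := fun s => ∫ t in (0 : ℝ)..s, F t with hΦ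
  have hΦc : ContinuousOn Φ (Ico 0 R) := primitive_facts hFi
  have hΦ0 : ∀ s ∈ Ico 0 R, 0 ≤ Φ s := by
    intro s hs
    refine intervalIntegral.integral_nonneg_of_ae_restrict hs.1 ?_
    rw [← restrict_Ioo_eq_restrict_Icc]
    exact (ae_restrict_iff' measurableSet_Ioo).2 (Eventually.of_forall fun t ht =>
      hF0 t ⟨ht.1, ht.2.trans hs.2⟩)
  have hΦb : ∀ ρ ∈ Ioo 0 R, ∃ M, ∀ s ∈ Ioc 0 ρ, Φ s ≤ M * s * w s := by
    intro ρ hρ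
    obtain ⟨M, hM0, hM⟩ := hFb ρ hρ
    refine ⟨M, fun s hs => ?_⟩
    have h1 : Φ s ≤ ∫ t in (0 : ℝ)..s, M * w s := by
      refine intervalIntegral.integral_mono_on_of_le_Ioo hs.1.le
        (hFi s ⟨hs.1, hs.2.trans_lt hρ.2⟩) (by simp) ?_
      intro t ht
      exact hM s hs t ⟨ht.1, ht.2.le⟩
    rw [intervalIntegral.integral_const] at h1
    simp only [sub_zero, smul_eq_mul] at h1
    linarith
  have hinner : ∀ s ∈ Ioo 0 R, ∫⁻ t in Ioo 0 s, ENNReal.ofReal (w t * b t) * ψ t ^ p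
      = ENNReal.ofReal (Φ s) := by
    intro s hs
    rw [← lintegral_Ioo_ofReal hs.1.le (hFi s hs) (fun t ht => hF0 t ⟨ht.1, ht.2.trans hs.2⟩)]
    refine setLIntegral_congr_fun measurableSet_Ioo fun t ht => ?_
    have htR : t ∈ Ioo 0 R := ⟨ht.1, ht.2.trans hs.2⟩
    show ENNReal.ofReal (w t * b t) * ψ t ^ p = ENNReal.ofReal (w t * b t * x t ^ p)
    rw [ENNReal.ofReal_mul (mul_nonneg (hwpos t htR).le (hb t ⟨htR.1.le, htR.2⟩).le),
      hxψ t ⟨htR.1.le, htR.2⟩, ENNReal.ofReal_rpow_of_nonneg (hx0 t) (by linarith)]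
  set g : ℝ → ℝ := fun s => Φ s / w s with hg
  have hgc : ContinuousOn g (Ioo 0 R) :=
    (hΦc.mono Ioo_subset_Ico_self).div (hwc.mono Ioo_subset_Ico_self) fun s hs => (hwpos s hs).ne'
  have hg0 : ∀ s ∈ Ioo 0 R, 0 ≤ g s := fun s hs =>
    div_nonneg (hΦ0 s ⟨hs.1.le, hs.2⟩) (hwpos s hs).le
  have hgi : ∀ r ∈ Ioo 0 R, IntervalIntegrable g volume 0 r := by
    intro r hr
    rw [intervalIntegrable_iff_integrableOn_Ioo_of_le hr.1.le]
    obtain ⟨M, hM⟩ := hΦb r hr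
    refine IntegrableOn.of_bound (C := |M| * r) measure_Ioo_lt_top
      ((hgc.mono (Ioo_subset_Ioo_right hr.2.le)).aestronglyMeasurable measurableSet_Ioo) ?_
    refine (ae_restrict_iff' measurableSet_Ioo).2 (Eventually.of_forall fun t ht => ?_)
    have htR : t ∈ Ioo 0 R := ⟨ht.1, ht.2.trans hr.2⟩
    rw [Real.norm_of_nonneg (hg0 t htR)]
    rw [hg]
    show Φ t / w t ≤ _
    rw [div_le_iff₀ (hwpos t htR)]
    refine (hM t ⟨ht.1, ht.2.le⟩).trans ?_
    have := (hwpos t htR).le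
    have h1 := le_abs_self M
    have h2 := ht.1.le
    have h3 := ht.2.le
    gcongr
  have hxeq : ∀ r ∈ Ico 0 R, x r = c.toReal + ∫ s in (0 : ℝ)..r, g s := by
    intro r hr
    rcases eq_or_lt_of_le hr.1 with h0 | h0
    · subst h0
      simp only [intervalIntegral.integral_same, add_zero, hx]
      rw [hψ 0]
      simp [radT]
    have hrR : r ∈ Ioo 0 R := ⟨h0, hr.2⟩
    have h1 : radT (fun s => ENNReal.ofReal (w s)⁻¹)
      (fun t => ENNReal.ofReal (w t * b t)) p ψ r = ENNReal.ofReal (∫ s in (0 : ℝ)..r, g s) := by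
      rw [← lintegral_Ioo_ofReal h0.le (hgi r hrR) (fun t ht => hg0 t ⟨ht.1, ht.2.trans hr.2⟩)]
      unfold radT
      refine setLIntegral_congr_fun measurableSet_Ioo fun t ht => ?_
      have htR : t ∈ Ioo 0 R := ⟨ht.1, ht.2.trans hr.2⟩
      show ENNReal.ofReal (w t)⁻¹ * _ = ENNReal.ofReal (Φ t / w t)
      rw [hinner t htR, ← ENNReal.ofReal_mul (inv_nonneg.2 (hwpos t htR).le)]
      congr 1
      ring
    have hcfin : c ≠ ⊤ := by
      have := hfin r hr
      rw [hψ r] at this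
      exact (ENNReal.add_ne_top.1 this).1
    have hgint : 0 ≤ ∫ s in (0 : ℝ)..r, g s := by
      refine intervalIntegral.integral_nonneg_of_ae_restrict hr.1 ?_
      rw [← restrict_Ioo_eq_restrict_Icc]
      exact (ae_restrict_iff' measurableSet_Ioo).2 (Eventually.of_forall fun t ht =>
        hg0 t ⟨ht.1, ht.2.trans hr.2⟩)
    show (ψ r).toReal = _
    rw [hψ r, h1, ENNReal.toReal_add hcfin ENNReal.ofReal_ne_top, ENNReal.toReal_ofReal hgint]
  have hxc : ContinuousOn x (Ico 0 R) :=
    (continuousOn_const.add (primitive_facts hgi)).congr hxeq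
  have hFc : ContinuousOn F (Ico 0 R) :=
    (hwc.mul hbc).mul (hxc.rpow_const fun _ _ => Or.inr (by linarith))
  refine ⟨x, Φ, hxψ, hx0, ?_, hmono, hxc, hΦc, ?_, hΦ0, ?_, ?_, hΦb⟩
  · rw [hxeq 0 ⟨le_rfl, hR⟩]; simp
  · simp [hΦ]
  · intro r hr
    have h1 := (primitive_deriv hgi hgc r hr).const_add c.toReal
    refine h1.congr_of_eventuallyEq ?_
    filter_upwards [isOpen_Ioo.mem_nhds hr] with y hy
    exact hxeq y ⟨hy.1.le, hy.2⟩
  · intro r hr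
    exact primitive_deriv hFi (hFc.mono Ioo_subset_Ico_self) r hr

end

open Set Filter

section
open MeasureTheory ENNReal

lemma rpow_add_le_lip {p M x y : ℝ} (hp : 1 < p) (hx : 0 ≤ x) (hxM : x ≤ M) (hy : 0 ≤ y)
    (hy1 : y ≤ 1) : (x + y) ^ p ≤ x ^ p + p * (M + 1) ^ (p - 1) * y := by
  rcases eq_or_lt_of_le (add_nonneg hx hy) with h0 | h0
  · have hx0 : x = 0 := by linarith
    have hy0 : y = 0 := by linarith
    subst hx0 hy0
    simp
  set z := x + y with hz
  have h1 := one_add_mul_self_le_rpow_one_add (s := -(y / z)) (p := p) (by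
    have : y / z ≤ 1 := by rw [div_le_one h0]; linarith
    linarith) hp.le
  have h2 : 1 + -(y / z) = x / z := by field_simp; rw [hz]; ring
  rw [h2, Real.div_rpow hx h0.le, le_div_iff₀ (Real.rpow_pos_of_pos h0 p)] at h1
  have h3 : z ^ p = z ^ (p - 1) * z := by
    rw [← Real.rpow_add_one h0.ne']; congr 1; ring
  have h4 : (1 + p * -(y / z)) * z ^ p = z ^ p - p * z ^ (p - 1) * y := by
    rw [h3]; field_simp; ring
  have h5 : z ^ (p - 1) ≤ (M + 1) ^ (p - 1) :=
    Real.rpow_le_rpow h0.le (by linarith) (by linarith)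
  rw [h4] at h1
  have : p * z ^ (p - 1) * y ≤ p * (M + 1) ^ (p - 1) * y := by gcongr
  linarith

lemma no_touch {w b x Φ U U' f : ℝ → ℝ} {R p : ℝ}
    (hwpos : ∀ r ∈ Ioo 0 R, 0 < w r)
    (hbc : ContinuousOn b (Ico 0 R)) (hxc : ContinuousOn x (Ico 0 R)) (hp : 1 < p)
    (hΦc : ContinuousOn Φ (Ico 0 R)) (hΦ0 : Φ 0 = 0)
    (hxd : ∀ r ∈ Ioo 0 R, HasDerivAt x (Φ r / w r) r)
    (hΦd : ∀ r ∈ Ioo 0 R, HasDerivAt Φ (w r * b r * x r ^ p) r)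
    (hUc : ContinuousOn U (Ico 0 R)) (hUd : ∀ r ∈ Ioo 0 R, HasDerivAt U (U' r) r)
    (hUw : ContinuousOn (fun r => w r * U' r) (Ico 0 R)) (hUw0 : w 0 * U' 0 = 0)
    (hUf : ∀ r ∈ Ioo 0 R, HasDerivAt (fun r => w r * U' r) (w r * f r) r)
    (hfc : ContinuousOn f (Ico 0 R)) (hf : ∀ r ∈ Ico 0 R, f r < b r * U r ^ p)
    (hle : ∀ r ∈ Ico 0 R, x r ≤ U r) :
    ∀ r ∈ Ico 0 R, x r < U r := by
  intro r hr
  by_contra! hcon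
  have heq : x r = U r := le_antisymm (hle r hr) hcon
  -- flux vanishes
  have hJ0 : w r * U' r - Φ r = 0 := by
    rcases eq_or_lt_of_le hr.1 with h0 | h0
    · subst h0; rw [hUw0, hΦ0]; simp
    · have hrR : r ∈ Ioo 0 R := ⟨h0, hr.2⟩
      have hmin : IsLocalMin (fun y => U y - x y) r := by
        filter_upwards [isOpen_Ioo.mem_nhds hrR] with y hy
        have := hle y ⟨hy.1.le, hy.2⟩
        simp only [heq, sub_self]
        linarith
      have := hmin.hasDerivAt_eq_zero ((hUd r hrR).sub (hxd r hrR))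
      have hw := (hwpos r hrR).ne'
      have h2 : U' r = Φ r / w r := by linarith
      rw [h2]; field_simp; simp
  have hcont : ContinuousOn (fun s => f s - b s * x s ^ p) (Ico 0 R) :=
    hfc.sub (hbc.mul (hxc.rpow_const fun _ _ => Or.inr (by linarith)))
  have hneg : f r - b r * x r ^ p < 0 := by
    rw [heq]; linarith [hf r hr]
  have hev : ∀ᶠ s in nhdsWithin r (Ico 0 R), f s - b s * x s ^ p < 0 :=
    (hcont r hr).eventually (gt_mem_nhds hneg)
  obtain ⟨e, he, hball⟩ := Metric.mem_nhdsWithin_iff.1 hev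
  set r' := min (r + e / 2) ((r + R) / 2) with hr'
  have hrr' : r < r' := by
    apply lt_min
    · linarith
    · linarith [hr.2]
  have hr'R : r' < R := (min_le_right _ _).trans_lt (by linarith [hr.2])
  have hsub : Icc r r' ⊆ Ico 0 R := fun y hy => ⟨hr.1.trans hy.1, hy.2.trans_lt hr'R⟩
  have hfneg : ∀ y ∈ Icc r r', f y - b y * x y ^ p < 0 := by
    intro y hy
    apply hball
    refine ⟨?_, hsub hy⟩
    rw [Metric.mem_ball, Real.dist_eq, abs_of_nonneg (by linarith [hy.1])]
    have : y ≤ r + e / 2 := hy.2.trans (min_le_left _ _)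
    linarith
  have hin : ∀ y ∈ interior (Icc r r'), y ∈ Ioo 0 R ∧ y ∈ Icc r r' := by
    intro y hy
    rw [interior_Icc] at hy
    exact ⟨⟨hr.1.trans_lt hy.1, hy.2.trans hr'R⟩, hy.1.le, hy.2.le⟩
  have hJ : StrictAntiOn (fun s => w s * U' s - Φ s) (Icc r r') := by
    refine strictAntiOn_of_hasDerivWithinAt_neg (convex_Icc _ _) ((hUw.sub hΦc).mono hsub)
      (f' := fun s => w s * f s - w s * b s * x s ^ p) ?_ ?_
    · intro y hy
      exact ((hUf y (hin y hy).1).sub (hΦd y (hin y hy).1)).hasDerivWithinAt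
    · intro y hy
      have h1 := hfneg y (hin y hy).2
      have h2 := hwpos y (hin y hy).1
      have : w y * f y - w y * b y * x y ^ p = w y * (f y - b y * x y ^ p) := by ring
      rw [this]
      exact mul_neg_of_pos_of_neg h2 h1
  have hD : StrictAntiOn (fun s => U s - x s) (Icc r r') := by
    refine strictAntiOn_of_hasDerivWithinAt_neg (convex_Icc _ _) ((hUc.sub hxc).mono hsub)
      (f' := fun s => U' s - Φ s / w s) ?_ ?_
    · intro y hy
      exact ((hUd y (hin y hy).1).sub (hxd y (hin y hy).1)).hasDerivWithinAt
    · intro y hy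
      have hw := hwpos y (hin y hy).1
      rw [interior_Icc] at hy
      have h1 : w y * U' y - Φ y < w r * U' r - Φ r :=
        hJ ⟨le_rfl, hrr'.le⟩ ⟨hy.1.le, hy.2.le⟩ hy.1
      rw [hJ0] at h1
      have : U' y - Φ y / w y = (w y * U' y - Φ y) / w y := by field_simp
      rw [this]
      exact div_neg_of_neg_of_pos h1 hw
  have h1 : U r' - x r' < U r - x r := hD ⟨le_rfl, hrr'.le⟩ ⟨hrr'.le, le_rfl⟩ hrr'
  have h2 := hle r' ⟨hr.1.trans hrr'.le, hr'R⟩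
  linarith

lemma exists_good_point {x x' v v' : ℝ → ℝ} {a c : ℝ} (hac : a < c)
    (hxc : ContinuousOn x (Icc a c)) (hvc : ContinuousOn v (Icc a c))
    (hxd : ∀ r ∈ Ioo a c, HasDerivAt x (x' r) r) (hvd : ∀ r ∈ Ioo a c, HasDerivAt v (v' r) r)
    (ha : v a ≤ x a) (hc : x c < v c) :
    ∃ ρ ∈ Ioo a c, x ρ < v ρ ∧ x' ρ < v' ρ := by
  have hcl : IsCompact (Icc a c ∩ (fun y => v y - x y) ⁻¹' Iic 0) :=
    isCompact_Icc.of_isClosed_subset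
      ((hvc.sub hxc).preimage_isClosed_of_isClosed isClosed_Icc isClosed_Iic) inter_subset_left
  obtain ⟨z, hz, hzmax⟩ := hcl.exists_isGreatest ⟨a, ⟨le_rfl, hac.le⟩, by
    simp only [mem_preimage, mem_Iic]; linarith⟩
  have hz0 : v z - x z ≤ 0 := hz.2
  have hzc : z < c := by
    rcases eq_or_lt_of_le hz.1.2 with h | h
    · subst h; linarith
    · exact h
  obtain ⟨ρ, hρ, hd⟩ := exists_hasDerivAt_eq_slope (fun y => v y - x y) (fun y => v' y - x' y) hzc
    ((hvc.sub hxc).mono (Icc_subset_Icc_left hz.1.1))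
    (fun y hy => (hvd y ⟨hz.1.1.trans_lt hy.1, hy.2⟩).sub (hxd y ⟨hz.1.1.trans_lt hy.1, hy.2⟩))
  refine ⟨ρ, ⟨hz.1.1.trans_lt hρ.1, hρ.2⟩, ?_, ?_⟩
  · by_contra! h
    have : ρ ≤ z := hzmax ⟨⟨hz.1.1.trans hρ.1.le, hρ.2.le⟩, by
      simp only [mem_preimage, mem_Iic]; linarith⟩
    linarith [hρ.1]
  · have : 0 < (v c - x c - (v z - x z)) / (c - z) := div_pos (by linarith) (by linarith)
    rw [← hd] at this
    linarith
end

open Set Filter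

section
open MeasureTheory ENNReal

lemma lintegral_Ioo_split (F : ℝ → ℝ≥0∞) {a b c : ℝ} :
    ∫⁻ t in Ioo a c, F t ≤ (∫⁻ t in Ioo a b, F t) + ∫⁻ t in Ioo b c, F t := by
  calc ∫⁻ t in Ioo a c, F t ≤ ∫⁻ t in (Ioc a b ∪ Ioo b c), F t := by
        apply lintegral_mono_set
        intro t ht
        rcases le_or_gt t b with h | h
        · exact Or.inl ⟨ht.1, h⟩
        · exact Or.inr ⟨h, ht.2⟩
    _ ≤ (∫⁻ t in Ioc a b, F t) + ∫⁻ t in Ioo b c, F t := lintegral_union_le _ _ _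
    _ = _ := by rw [restrict_Ioo_eq_restrict_Ioc, restrict_Ioo_eq_restrict_Ioc]

lemma exists_barrier {w b x Φ U v v' g : ℝ → ℝ} {R p c rv ρ : ℝ} (hp : 1 < p)
    (hwpos : ∀ r ∈ Ioo 0 R, 0 < w r)
    (hbc : ContinuousOn b (Ico 0 R))
    (hb : ∀ r ∈ Ico 0 R, 0 < b r)
    (hwC : ∀ ρ ∈ Ioo 0 R, ∃ C > 0, ∀ s ∈ Ioc 0 ρ, ∀ t ∈ Ioc 0 s, w t ≤ C * w s)
    (hxc : ContinuousOn x (Ico 0 R)) (hx0 : ∀ r, 0 ≤ x r)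
    (hxcc : x 0 = c)
    (hΦc : ContinuousOn Φ (Ico 0 R)) (hΦ0 : Φ 0 = 0) (hΦn : ∀ r ∈ Ico 0 R, 0 ≤ Φ r)
    (hxd : ∀ r ∈ Ioo 0 R, HasDerivAt x (Φ r / w r) r)
    (hΦd : ∀ r ∈ Ioo 0 R, HasDerivAt Φ (w r * b r * x r ^ p) r)
    (hUc : ContinuousOn U (Ico 0 R)) (hxU : ∀ r ∈ Ico 0 R, x r < U r)
    (hrv : 0 ≤ rv)
    (hvd : ∀ r ∈ Ioo rv R, HasDerivAt v (v' r) r)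
    (hvw : ∀ r ∈ Ioo rv R, HasDerivAt (fun r => w r * v' r) (w r * g r) r)
    (hvpos : ∀ r ∈ Ioo rv R, 0 < v r)
    (hg : ∀ r ∈ Ioo rv R, b r * v r ^ p ≤ g r)
    (hvU : ∀ r ∈ Ioo rv R, v r ≤ U r)
    (hρ : ρ ∈ Ioo rv R) (hρ1 : x ρ < v ρ) (hρ2 : Φ ρ / w ρ < v' ρ) :
    ∃ δ : ℝ≥0∞, δ ≠ 0 ∧ ∃ h : ℝ → ℝ≥0∞,
      (∀ r, ENNReal.ofReal c + δ + radT (fun s => ENNReal.ofReal (w s)⁻¹)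
        (fun t => ENNReal.ofReal (w t * b t)) p h r ≤ h r) ∧
      ∀ r ∈ Ico 0 R, h r ≤ ENNReal.ofReal (U r) := by
  have hρ0 : 0 < ρ := hrv.trans_lt hρ.1
  have hρR : ρ ∈ Ioo 0 R := ⟨hρ0, hρ.2⟩
  have hρsub : Icc 0 ρ ⊆ Ico 0 R := Icc_subset_Ico_right hρ.2
  obtain ⟨C, hC, hCw⟩ := hwC ρ hρR
  obtain ⟨B, hB⟩ := (isCompact_Icc (a := 0) (b := ρ)).bddAbove_image (hbc.mono hρsub)
  have hB' : ∀ t ∈ Icc 0 ρ, b t ≤ B := fun t ht => hB (mem_image_of_mem b ht)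
  have hB0 : 0 ≤ B := (hb ρ ⟨hρ0.le, hρ.2⟩).le.trans (hB' ρ ⟨hρ0.le, le_rfl⟩)
  obtain ⟨M, hM⟩ := (isCompact_Icc (a := 0) (b := ρ)).bddAbove_image (hxc.mono hρsub)
  have hM' : ∀ t ∈ Icc 0 ρ, x t ≤ M := fun t ht => hM (mem_image_of_mem x ht)
  have hM0 : 0 ≤ M := (hx0 ρ).trans (hM' ρ ⟨hρ0.le, le_rfl⟩)
  obtain ⟨η, hη, hηU⟩ : ∃ η > 0, ∀ t ∈ Icc 0 ρ, η ≤ U t - x t := by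
    obtain ⟨t0, ht0, hmin⟩ := (isCompact_Icc (a := 0) (b := ρ)).exists_isMinOn ⟨0, le_rfl, hρ0.le⟩
      ((hUc.sub hxc).mono hρsub)
    exact ⟨U t0 - x t0, by linarith [hxU t0 (hρsub ht0)], fun t ht => hmin ht⟩
  set L := p * (M + 1) ^ (p - 1) with hL
  have hL0 : 0 ≤ L := by positivity
  set lam := C * B * L + 1 with hlam
  have hCBL : 0 ≤ C * B * L := by positivity
  have hlam1 : 1 ≤ lam := by linarith
  have hlam2 : C * B * L ≤ lam ^ 2 := by nlinarith
  set E := Real.exp (lam * ρ) with hE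
  have hE0 : 0 < E := Real.exp_pos _
  obtain ⟨m, hm, hm1, hm2, hm3, hm4⟩ : ∃ m > 0, m ≤ 1 ∧ x ρ + m ≤ v ρ ∧
      Φ ρ / w ρ + lam * m ≤ v' ρ ∧ m ≤ η := by
    refine ⟨min (min 1 (v ρ - x ρ)) (min ((v' ρ - Φ ρ / w ρ) / lam) η), ?_, ?_, ?_, ?_, ?_⟩
    · refine lt_min (lt_min one_pos (by linarith)) (lt_min ?_ hη)
      exact div_pos (by linarith) (by linarith)
    · exact (min_le_left _ _).trans (min_le_left _ _)
    · have := (min_le_left (min 1 (v ρ - x ρ)) (min ((v' ρ - Φ ρ / w ρ) / lam) η)).trans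
        (min_le_right _ _)
      linarith
    · have := (min_le_right (min 1 (v ρ - x ρ)) (min ((v' ρ - Φ ρ / w ρ) / lam) η)).trans
        (min_le_left _ _)
      rw [le_div_iff₀ (by linarith)] at this
      linarith
    · exact (min_le_right _ _).trans (min_le_right _ _)
  set δ := m / E with hδ
  have hδ0 : 0 < δ := div_pos hm hE0
  have hδE : δ * E = m := div_mul_cancel₀ _ hE0.ne'
  set e : ℝ → ℝ := fun t => Real.exp (lam * t) with he
  have hed : ∀ t, HasDerivAt e (lam * e t) t := by
    intro t
    have := ((hasDerivAt_id t).const_mul lam).exp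
    simp only [id, mul_one] at this
    rw [mul_comm]
    exact this
  have he0 : ∀ t, 0 < e t := fun t => Real.exp_pos _
  have hele : ∀ t ≤ ρ, δ * e t ≤ m := by
    intro t ht
    rw [← hδE]
    have : e t ≤ E := Real.exp_le_exp.2 (by nlinarith)
    gcongr
  have hec : Continuous e := by fun_prop
  set H : ℝ → ℝ := fun r => if r ≤ ρ then x r + δ * e r else v r with hH
  classical
  set h : ℝ → ℝ≥0∞ := fun r => if r ∈ Ico 0 R then ENNReal.ofReal (H r) else ⊤ with hh
  have hh1 : ∀ r ∈ Icc 0 ρ, h r = ENNReal.ofReal (x r + δ * e r) := by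
    intro r hr
    simp only [hh, hH, if_pos (hρsub hr), if_pos hr.2]
  have hh2 : ∀ r ∈ Ioo ρ R, h r = ENNReal.ofReal (v r) := by
    intro r hr
    simp only [hh, hH, if_pos (show r ∈ Ico 0 R from ⟨hρ0.le.trans hr.1.le, hr.2⟩),
      if_neg (not_le.2 hr.1)]
  set I : ℝ → ℝ≥0∞ := fun s => ∫⁻ t in Ioo 0 s, ENNReal.ofReal (w t * b t) * h t ^ p with hI
  have hinner1 : ∀ s ∈ Ioc 0 ρ, I s ≤ ENNReal.ofReal (Φ s + δ * w s * lam * e s) := by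
    intro s hs
    have hsR : s ∈ Ioo 0 R := ⟨hs.1, hs.2.trans_lt hρ.2⟩
    have hws := hwpos s hsR
    have hFTC := lintegral_Ioo_deriv (P := fun t => Φ t + δ * w s * lam * e t)
      (P' := fun t => w t * b t * x t ^ p + δ * w s * lam * (lam * e t)) hs.1.le
      ((hΦc.mono (Icc_subset_Ico_right hsR.2)).add (by fun_prop))
      (fun t ht => (hΦd t ⟨ht.1, ht.2.trans hsR.2⟩).add ((hed t).const_mul _))
      (fun t ht => by
        have htR : t ∈ Ioo 0 R := ⟨ht.1, ht.2.trans hsR.2⟩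
        have h1 := hwpos t htR
        have h2 := hb t ⟨ht.1.le, htR.2⟩
        have h3 := Real.rpow_nonneg (hx0 t) p
        have h4 := he0 t
        positivity)
    calc I s ≤ ∫⁻ t in Ioo 0 s,
          ENNReal.ofReal (w t * b t * x t ^ p + δ * w s * lam * (lam * e t)) := by
          refine setLIntegral_mono' measurableSet_Ioo fun t ht => ?_
          have htR : t ∈ Ioo 0 R := ⟨ht.1, ht.2.trans hsR.2⟩
          have htρ : t ∈ Icc 0 ρ := ⟨ht.1.le, ht.2.le.trans hs.2⟩
          have h1 := hwpos t htR
          have h2 := hb t ⟨ht.1.le, htR.2⟩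
          have h4 := he0 t
          have h5 := hx0 t
          rw [hh1 t htρ, ENNReal.ofReal_rpow_of_nonneg (by positivity) (by linarith),
            ← ENNReal.ofReal_mul (by positivity)]
          apply ENNReal.ofReal_le_ofReal
          have h6 := rpow_add_le_lip (y := δ * e t) hp h5 (hM' t htρ) (by positivity)
            ((hele t htρ.2).trans hm1)
          have h7 : w t * b t ≤ C * w s * B := by
            have := hCw s hs t ⟨ht.1, ht.2.le⟩
            have := hB' t htρ
            gcongr
          calc w t * b t * (x t + δ * e t) ^ p
              ≤ w t * b t * (x t ^ p + L * (δ * e t)) := by gcongr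
            _ = w t * b t * x t ^ p + w t * b t * (L * (δ * e t)) := by ring
            _ ≤ w t * b t * x t ^ p + C * w s * B * (L * (δ * e t)) := by gcongr
            _ = w t * b t * x t ^ p + (C * B * L) * (w s * (δ * e t)) := by ring
            _ ≤ w t * b t * x t ^ p + lam ^ 2 * (w s * (δ * e t)) := by gcongr
            _ = _ := by ring
      _ = _ := hFTC
      _ ≤ _ := by
          apply ENNReal.ofReal_le_ofReal
          simp only [hΦ0]
          have := he0 0
          have : 0 ≤ δ * w s * lam * e 0 := by positivity
          linarith
  have houter1 : ∀ r ∈ Icc 0 ρ, (∫⁻ s in Ioo 0 r, ENNReal.ofReal (w s)⁻¹ * I s)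
      ≤ ENNReal.ofReal (x r + δ * e r - (c + δ)) := by
    intro r hr
    have hrR := hρsub hr
    have hFTC := lintegral_Ioo_deriv (P := fun t => x t + δ * e t)
      (P' := fun t => Φ t / w t + δ * (lam * e t)) hr.1
      ((hxc.mono (Icc_subset_Ico_right hrR.2)).add (by fun_prop))
      (fun t ht => (hxd t ⟨ht.1, ht.2.trans hrR.2⟩).add ((hed t).const_mul _))
      (fun t ht => by
        have htR : t ∈ Ioo 0 R := ⟨ht.1, ht.2.trans hrR.2⟩
        have h1 := hwpos t htR
        have h2 := hΦn t ⟨ht.1.le, htR.2⟩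
        have h4 := he0 t
        positivity)
    have : e 0 = 1 := by simp [he]
    simp only [this, mul_one, hxcc] at hFTC
    rw [← hFTC]
    refine setLIntegral_mono' measurableSet_Ioo fun t ht => ?_
    have htR : t ∈ Ioo 0 R := ⟨ht.1, ht.2.trans hrR.2⟩
    have h1 := hwpos t htR
    calc ENNReal.ofReal (w t)⁻¹ * I t
        ≤ ENNReal.ofReal (w t)⁻¹ * ENNReal.ofReal (Φ t + δ * w t * lam * e t) := by
          gcongr
          exact hinner1 t ⟨ht.1, ht.2.le.trans hr.2⟩
      _ = ENNReal.ofReal (Φ t / w t + δ * (lam * e t)) := by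
          rw [← ENNReal.ofReal_mul (by positivity)]
          congr 1
          field_simp
  have hsubρ : ∀ s ∈ Ico ρ R, Icc ρ s ⊆ Ioo rv R := fun s hs y hy =>
    ⟨hρ.1.trans_le hy.1, hy.2.trans_lt hs.2⟩
  have hwρ := hwpos ρ hρR
  have hgn : ∀ s ∈ Ioo rv R, 0 ≤ w s * g s := by
    intro s hs
    have h0 := hwpos s ⟨hrv.trans_lt hs.1, hs.2⟩
    have h1 := hb s ⟨hrv.trans hs.1.le, hs.2⟩
    have h2 := hvpos s hs
    have h3 := hg s hs
    have : 0 ≤ b s * v s ^ p := by positivity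
    exact mul_nonneg h0.le (this.trans h3)
  have hflux : ∀ s ∈ Ico ρ R, w ρ * v' ρ ≤ w s * v' s := by
    intro s hs
    refine monotoneOn_of_hasDerivWithinAt_nonneg (convex_Icc ρ s)
      (f := fun r => w r * v' r) (f' := fun r => w r * g r) ?_ ?_ ?_
      ⟨le_rfl, hs.1⟩ ⟨hs.1, le_rfl⟩ hs.1
    · exact fun y hy => (hvw y (hsubρ s hs hy)).continuousAt.continuousWithinAt
    · exact fun y hy => (hvw y (hsubρ s hs (interior_subset hy))).hasDerivWithinAt
    · exact fun y hy => hgn y (hsubρ s hs (interior_subset hy))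
  have hv'ρ : 0 < v' ρ := (div_nonneg (hΦn ρ ⟨hρ0.le, hρ.2⟩) hwρ.le).trans_lt hρ2
  have hv'n : ∀ s ∈ Ico ρ R, 0 ≤ v' s := by
    intro s hs
    have h0 := hwpos s ⟨hρ0.trans_le hs.1, hs.2⟩
    have h1 := hflux s hs
    have h2 : 0 < w ρ * v' ρ := by positivity
    exact (pos_of_mul_pos_right (h2.trans_le h1) h0.le).le
  have hinner2 : ∀ s ∈ Ioo ρ R, I s ≤ ENNReal.ofReal (w s * v' s) := by
    intro s hs
    have hs' : s ∈ Ico ρ R := ⟨hs.1.le, hs.2⟩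
    have hFTC := lintegral_Ioo_deriv (P := fun t => w t * v' t)
      (P' := fun t => w t * g t) hs.1.le
      (fun y hy => (hvw y (hsubρ s hs' hy)).continuousAt.continuousWithinAt)
      (fun y hy => hvw y (hsubρ s hs' (Ioo_subset_Icc_self hy)))
      (fun y hy => hgn y (hsubρ s hs' (Ioo_subset_Icc_self hy)))
    have h1 : ∫⁻ t in Ioo ρ s, ENNReal.ofReal (w t * b t) * h t ^ p
        ≤ ENNReal.ofReal (w s * v' s - w ρ * v' ρ) := by
      rw [← hFTC]
      refine setLIntegral_mono' measurableSet_Ioo fun t ht => ?_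
      have htR : t ∈ Ioo rv R := hsubρ s hs' (Ioo_subset_Icc_self ht)
      have h0 := hwpos t ⟨hrv.trans_lt htR.1, htR.2⟩
      have h1 := hb t ⟨hrv.trans htR.1.le, htR.2⟩
      have h2 := hvpos t htR
      rw [hh2 t ⟨ht.1, htR.2⟩, ENNReal.ofReal_rpow_of_nonneg h2.le (by linarith),
            ← ENNReal.ofReal_mul (by positivity)]
      apply ENNReal.ofReal_le_ofReal
      rw [mul_assoc]
      exact mul_le_mul_of_nonneg_left (hg t htR) h0.le
    have h2 := hinner1 ρ ⟨hρ0, le_rfl⟩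
    have h3 : Φ ρ + δ * w ρ * lam * e ρ ≤ w ρ * v' ρ := by
      have h4 : δ * e ρ = m := hδE
      have h5 : Φ ρ + δ * w ρ * lam * e ρ = w ρ * (Φ ρ / w ρ + lam * (δ * e ρ)) := by
        field_simp
      rw [h5, h4]
      gcongr
    calc I s ≤ I ρ + ∫⁻ t in Ioo ρ s, ENNReal.ofReal (w t * b t) * h t ^ p :=
          lintegral_Ioo_split _
      _ ≤ ENNReal.ofReal (w ρ * v' ρ) + ENNReal.ofReal (w s * v' s - w ρ * v' ρ) :=
          add_le_add (h2.trans (ENNReal.ofReal_le_ofReal h3)) h1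
      _ = _ := by
          rw [← ENNReal.ofReal_add (by positivity) (by linarith [hflux s hs'])]
          congr 1; ring
  have hvmono : ∀ r ∈ Ico ρ R, v ρ ≤ v r := by
    intro s hs
    refine monotoneOn_of_hasDerivWithinAt_nonneg (convex_Icc ρ s)
      (f := v) (f' := v') ?_ ?_ ?_
      ⟨le_rfl, hs.1⟩ ⟨hs.1, le_rfl⟩ hs.1
    · exact fun y hy => (hvd y (hsubρ s hs hy)).continuousAt.continuousWithinAt
    · exact fun y hy => (hvd y (hsubρ s hs (interior_subset hy))).hasDerivWithinAt
    · intro y hy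
      have := interior_subset hy
      exact hv'n y ⟨this.1, this.2.trans_lt hs.2⟩
  have hxmono : ∀ r ∈ Ico 0 R, c ≤ x r := by
    intro s hs
    rw [← hxcc]
    refine monotoneOn_of_hasDerivWithinAt_nonneg (convex_Icc 0 s)
      (f := x) (f' := fun r => Φ r / w r) (hxc.mono (Icc_subset_Ico_right hs.2)) ?_ ?_
      ⟨le_rfl, hs.1⟩ ⟨hs.1, le_rfl⟩ hs.1
    · intro y hy
      rw [interior_Icc] at hy
      exact (hxd y ⟨hy.1, hy.2.trans hs.2⟩).hasDerivWithinAt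
    · intro y hy
      rw [interior_Icc] at hy
      exact div_nonneg (hΦn y ⟨hy.1.le, hy.2.trans hs.2⟩) (hwpos y ⟨hy.1, hy.2.trans hs.2⟩).le
  have hc0 : 0 ≤ c := hxcc ▸ hx0 0
  have hgap : ∀ r ∈ Icc 0 ρ, 0 ≤ x r + δ * e r - (c + δ) := by
    intro r hr
    have h1 := hxmono r (hρsub hr)
    have h2 : 1 ≤ e r := Real.one_le_exp (by have := hr.1; positivity)
    nlinarith
  refine ⟨ENNReal.ofReal δ, by simpa using hδ0, h, ?_, ?_⟩
  · intro r
    by_cases hr : r ∈ Ico 0 R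
    swap
    · simp only [hh, if_neg hr, le_top]
    rw [← ENNReal.ofReal_add hc0 hδ0.le]
    have hT : radT (fun s => ENNReal.ofReal (w s)⁻¹) (fun t => ENNReal.ofReal (w t * b t)) p h r
      = ∫⁻ s in Ioo 0 r, ENNReal.ofReal (w s)⁻¹ * I s := rfl
    rw [hT]
    rcases le_or_gt r ρ with hrρ | hrρ
    · rw [hh1 r ⟨hr.1, hrρ⟩]
      calc _ ≤ ENNReal.ofReal (c + δ) + ENNReal.ofReal (x r + δ * e r - (c + δ)) := by
            gcongr
            exact houter1 r ⟨hr.1, hrρ⟩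
        _ = _ := by
            rw [← ENNReal.ofReal_add (by positivity) (hgap r ⟨hr.1, hrρ⟩)]
            congr 1; ring
    · rw [hh2 r ⟨hrρ, hr.2⟩]
      have hr' : r ∈ Ico ρ R := ⟨hrρ.le, hr.2⟩
      have hFTC := lintegral_Ioo_deriv (P := v) (P' := v') hrρ.le
        (fun y hy => (hvd y (hsubρ r hr' hy)).continuousAt.continuousWithinAt)
        (fun y hy => hvd y (hsubρ r hr' (Ioo_subset_Icc_self hy)))
        (fun y hy => hv'n y ⟨hy.1.le, hy.2.trans hr.2⟩)
      have h1 : ∫⁻ s in Ioo ρ r, ENNReal.ofReal (w s)⁻¹ * I s ≤ ENNReal.ofReal (v r - v ρ) := by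
        rw [← hFTC]
        refine setLIntegral_mono' measurableSet_Ioo fun t ht => ?_
        have h0 := hwpos t ⟨hρ0.trans ht.1, ht.2.trans hr.2⟩
        calc ENNReal.ofReal (w t)⁻¹ * I t
            ≤ ENNReal.ofReal (w t)⁻¹ * ENNReal.ofReal (w t * v' t) := by
              gcongr
              exact hinner2 t ⟨ht.1, ht.2.trans hr.2⟩
          _ = ENNReal.ofReal (v' t) := by
              rw [← ENNReal.ofReal_mul (by positivity)]
              congr 1
              field_simp
      have hρmem : ρ ∈ Icc 0 ρ := ⟨hρ0.le, le_rfl⟩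
      have hg1 := hgap ρ hρmem
      have hg2 := hvmono r hr'
      have h4 : δ * e ρ = m := hδE
      calc _ ≤ ENNReal.ofReal (c + δ) + (ENNReal.ofReal (x ρ + δ * e ρ - (c + δ))
              + ENNReal.ofReal (v r - v ρ)) := by
            gcongr
            exact (lintegral_Ioo_split (b := ρ) _).trans (add_le_add (houter1 ρ hρmem) h1)
        _ = ENNReal.ofReal (c + δ + ((x ρ + δ * e ρ - (c + δ)) + (v r - v ρ))) := by
            rw [← ENNReal.ofReal_add hg1 (by linarith), ← ENNReal.ofReal_add (by positivity)]
            linarith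
        _ ≤ _ := by
            apply ENNReal.ofReal_le_ofReal
            linarith
  · intro r hr
    rcases le_or_gt r ρ with hrρ | hrρ
    · rw [hh1 r ⟨hr.1, hrρ⟩]
      apply ENNReal.ofReal_le_ofReal
      have := hηU r ⟨hr.1, hrρ⟩
      have := hele r hrρ
      linarith
    · rw [hh2 r ⟨hrρ, hr.2⟩]
      exact ENNReal.ofReal_le_ofReal (hvU r ⟨hρ.1.trans hrρ, hr.2⟩)

theorem abstract_existence {w b U U' f v v' g : ℝ → ℝ} {R p rv : ℝ} (hp : 1 < p) (hR : 0 < R)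
    (hwm : Measurable w) (hbm : Measurable b) (hwpos : ∀ r ∈ Ioo 0 R, 0 < w r)
    (hwc : ContinuousOn w (Ico 0 R)) (hbc : ContinuousOn b (Ico 0 R))
    (hb : ∀ r ∈ Ico 0 R, 0 < b r)
    (hwC : ∀ ρ ∈ Ioo 0 R, ∃ C > 0, ∀ s ∈ Ioc 0 ρ, ∀ t ∈ Ioc 0 s, w t ≤ C * w s)
    (hUpos : ∀ r ∈ Ico 0 R, 0 < U r)
    (hUc : ContinuousOn U (Ico 0 R)) (hUd : ∀ r ∈ Ioo 0 R, HasDerivAt U (U' r) r)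
    (hUw : ContinuousOn (fun r => w r * U' r) (Ico 0 R)) (hUw0 : w 0 * U' 0 = 0)
    (hUf : ∀ r ∈ Ioo 0 R, HasDerivAt (fun r => w r * U' r) (w r * f r) r)
    (hfc : ContinuousOn f (Ico 0 R)) (hf : ∀ r ∈ Ico 0 R, f r < b r * U r ^ p)
    (hrv : 0 ≤ rv) (hrvR : rv < R)
    (hvc : ContinuousOn v (Ico rv R))
    (hvd : ∀ r ∈ Ioo rv R, HasDerivAt v (v' r) r)
    (hvw : ∀ r ∈ Ioo rv R, HasDerivAt (fun r => w r * v' r) (w r * g r) r)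
    (hv0 : v rv ≤ 0) (hvpos : ∀ r ∈ Ioo rv R, 0 < v r)
    (hg : ∀ r ∈ Ioo rv R, b r * v r ^ p ≤ g r)
    (hvU : ∀ r ∈ Ioo rv R, v r ≤ U r) :
    ∃ x Φ : ℝ → ℝ, (∀ r ∈ Ico 0 R, 0 < x r) ∧ ContinuousOn x (Ico 0 R) ∧
      ContinuousOn Φ (Ico 0 R) ∧ (∀ r ∈ Ico 0 R, 0 ≤ Φ r) ∧
      (∀ r ∈ Ioo 0 R, HasDerivAt x (Φ r / w r) r) ∧
      (∀ r ∈ Ioo 0 R, HasDerivAt Φ (w r * b r * x r ^ p) r) ∧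
      (∀ ρ ∈ Ioo 0 R, ∃ M, ∀ s ∈ Ioc 0 ρ, Φ s ≤ M * s * w s) ∧
      (∀ r ∈ Ico 0 R, x r ≤ U r) ∧ (∀ r ∈ Ioo rv R, v r ≤ x r) := by
  obtain ⟨c, ψ, hct, hψ, hψU, hcrit, hc0⟩ := exists_critical
    (fun s => ENNReal.ofReal (w s)⁻¹) (fun t => ENNReal.ofReal (w t * b t))
    hwm.inv.ennreal_ofReal (hwm.mul hbm).ennreal_ofReal (p := p) (by linarith)
    (fun r => ENNReal.ofReal (U r)) hR ENNReal.ofReal_ne_top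
  obtain ⟨x, Φ, hxψ, hx0, hxc0, hmono, hxc, hΦc, hΦ0, hΦn, hxd, hΦd, hΦb⟩ :=
    real_extract hp hwm hbm hwpos hwc hbc hb hwC hψ
      (fun r hr => ne_top_of_le_ne_top ENNReal.ofReal_ne_top (hψU r hr)) hR
  have hxU : ∀ r ∈ Ico 0 R, x r ≤ U r := by
    intro r hr
    have := hψU r hr
    rw [hxψ r hr] at this
    exact (ENNReal.ofReal_le_ofReal_iff (hUpos r hr).le).1 this
  have hxU' := no_touch hwpos hbc hxc hp hΦc hΦ0 hxd hΦd hUc hUd hUw hUw0 hUf hfc hf hxU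
  have hvx : ∀ r ∈ Ioo rv R, v r ≤ x r := by
    intro r hr
    by_contra! hcon
    have hsub : Icc rv r ⊆ Ico 0 R := fun y hy => ⟨hrv.trans hy.1, hy.2.trans_lt hr.2⟩
    obtain ⟨ρ, hρ, h1, h2⟩ := exists_good_point (x' := fun r => Φ r / w r) hr.1 (hxc.mono hsub)
      (hvc.mono (Icc_subset_Ico_right hr.2))
      (fun y hy => hxd y ⟨hrv.trans_lt hy.1, hy.2.trans hr.2⟩)
      (fun y hy => hvd y ⟨hy.1, hy.2.trans hr.2⟩) (hv0.trans (hx0 rv)) hcon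
    obtain ⟨δ, hδ, h, hh, hhU⟩ := exists_barrier hp hwpos hbc hb hwC hxc hx0 hxc0 hΦc hΦ0 hΦn hxd
      hΦd hUc hxU' hrv hvd hvw hvpos hg hvU ⟨hρ.1, hρ.2.trans hr.2⟩ h1 h2
    rw [ENNReal.ofReal_toReal hct] at hh
    obtain ⟨y, hy, hlt⟩ := hcrit δ hδ h hh
    exact absurd (hhU y hy) (not_le.2 hlt)
  refine ⟨x, Φ, ?_, hxc, hΦc, hΦn, hxd, hΦd, hΦb, hxU, hvx⟩
  intro r hr
  have hcne : c ≠ 0 := by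
    intro h
    obtain ⟨y, hy1, hy2⟩ := exists_between hrvR
    have h1 := hvx y ⟨hy1, hy2⟩
    have h2 := hvpos y ⟨hy1, hy2⟩
    have h3 := hxψ y ⟨hrv.trans hy1.le, hy2⟩
    rw [hc0 h y] at h3
    have := ENNReal.ofReal_eq_zero.1 h3.symm
    linarith
  have h1 : c ≤ ψ r := by rw [hψ r]; exact le_self_add
  have h2 : 0 < ENNReal.ofReal (x r) := by
    rw [← hxψ r hr]
    exact (pos_iff_ne_zero.2 hcne).trans_le h1
  simpa using h2

end

open Set Filter

section
open Topology

lemma weight_deriv {n : ℕ} {R α r : ℝ} (hr : r ∈ Ioo 0 R) {F : ℝ → ℝ} {F2 : ℝ}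
    (hF : HasDerivAt F F2 r) :
    HasDerivAt (fun r => r ^ n * (R - r) ^ α * F r)
      (r ^ n * (R - r) ^ α * (F2 + ((n : ℝ) / r - α / (R - r)) * F r)) r := by
  have h0 : 0 < R - r := by linarith [hr.2]
  have hr0 := hr.1
  have h1 : HasDerivAt (fun r : ℝ => (R - r) ^ α) (-1 * α * (R - r) ^ (α - 1)) r :=
    ((hasDerivAt_id r).const_sub R).rpow_const (Or.inl h0.ne')
  have h2 := ((hasDerivAt_pow n r).mul h1).mul hF
  refine h2.congr_deriv ?_
  have h3 : (R - r) ^ α = (R - r) ^ (α - 1) * (R - r) := by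
    rw [← Real.rpow_add_one h0.ne']; congr 1; ring
  have h4 : (n : ℝ) * r ^ (n - 1) = r ^ n * (n / r) := by
    rcases n with _ | n
    · simp
    · simp only [Nat.add_sub_cancel, pow_succ]
      field_simp
  simp only [Pi.mul_apply]
  rw [h4, h3]
  field_simp
  ring

lemma weight_bound {n : ℕ} {R α : ℝ} (ρ : ℝ) (hρ : ρ ∈ Ioo 0 R) :
    ∃ C > 0, ∀ s ∈ Ioc 0 ρ, ∀ t ∈ Ioc 0 s,
      t ^ n * (R - t) ^ α ≤ C * (s ^ n * (R - s) ^ α) := by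
  have hcont : ContinuousOn (fun s : ℝ => (R - s) ^ α) (Icc 0 ρ) :=
    (by fun_prop : Continuous fun s : ℝ => R - s).continuousOn.rpow_const fun s hs =>
      Or.inl (by have := hs.2; have := hρ.2; intro h; linarith)
  have hpos : ∀ s ∈ Icc 0 ρ, 0 < (R - s) ^ α := fun s hs =>
    Real.rpow_pos_of_pos (by linarith [hs.2, hρ.2]) α
  have hne : (Icc 0 ρ).Nonempty := ⟨0, le_rfl, hρ.1.le⟩
  obtain ⟨s1, hs1, hmin⟩ := isCompact_Icc.exists_isMinOn hne hcont
  obtain ⟨s2, hs2, hmax⟩ := isCompact_Icc.exists_isMaxOn hne hcont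
  have p1 := hpos s1 hs1
  have p2 := hpos s2 hs2
  refine ⟨(R - s2) ^ α / (R - s1) ^ α, div_pos p2 p1, ?_⟩
  intro s hs t ht
  have hsI : s ∈ Icc 0 ρ := ⟨hs.1.le, hs.2⟩
  have h1 : (R - t) ^ α ≤ (R - s2) ^ α := hmax (show t ∈ Icc 0 ρ from ⟨ht.1.le, ht.2.trans hs.2⟩)
  have h2 : (R - s1) ^ α ≤ (R - s) ^ α := hmin hsI
  have h3 : t ^ n ≤ s ^ n := pow_le_pow_left₀ ht.1.le ht.2 n
  have h4 : 0 ≤ s ^ n := pow_nonneg hs.1.le n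
  have h5 : 0 ≤ t ^ n := pow_nonneg ht.1.le n
  calc t ^ n * (R - t) ^ α ≤ s ^ n * (R - s2) ^ α := by
        have := hpos t ⟨ht.1.le, ht.2.trans hs.2⟩
        gcongr
    _ = (R - s2) ^ α / (R - s1) ^ α * (s ^ n * (R - s1) ^ α) := by field_simp
    _ ≤ _ := by gcongr

/-- derivative of `(R-r)^(-β)`-type powers -/
lemma deriv_dist {R β r : ℝ} (hr : r < R) :
    HasDerivAt (fun r : ℝ => (R - r) ^ (-β)) (β * (R - r) ^ (-β - 1)) r := by
  have h0 : 0 < R - r := by linarith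
  have h1 := ((hasDerivAt_id r).const_sub R).rpow_const (p := -β) (Or.inl (by simpa using h0.ne'))
  refine h1.congr_deriv ?_
  simp only [id]
  ring

lemma deriv_quad {R β r : ℝ} (hr : r ∈ Ico 0 R) :
    HasDerivAt (fun r : ℝ => (R ^ 2 - r ^ 2) ^ (-β)) (2 * β * r * (R ^ 2 - r ^ 2) ^ (-β - 1)) r := by
  have h0 : 0 < R ^ 2 - r ^ 2 := by nlinarith [hr.1, hr.2]
  have h1 := ((hasDerivAt_pow 2 r).const_sub (R ^ 2)).rpow_const (p := -β) (Or.inl h0.ne')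
  refine h1.congr_deriv ?_
  push_cast
  ring

lemma exists_super_const {b f z : ℝ → ℝ} {R R0 p k : ℝ} (hp : 1 < p) (hk : 0 < k)
    (hR0 : 0 ≤ R0) (hR0R : R0 < R)
    (hbc : ContinuousOn b (Ico 0 R)) (hb : ∀ r ∈ Ico 0 R, 0 < b r)
    (hfc : ContinuousOn f (Ico 0 R)) (hz : ∀ r ∈ Ico 0 R, 0 < z r)
    (hnear : ∀ r ∈ Ioo R0 R, f r < b r * (k * z r) ^ p) :
    ∃ A > 0, ∀ r ∈ Ico 0 R, f r < b r * (A + k * z r) ^ p := by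
  have hsub : Icc 0 R0 ⊆ Ico 0 R := Icc_subset_Ico_right hR0R
  have hne : (Icc 0 R0).Nonempty := ⟨0, le_rfl, hR0⟩
  obtain ⟨s1, hs1, hmin⟩ := isCompact_Icc.exists_isMinOn hne (hbc.mono hsub)
  obtain ⟨s2, hs2, hmax⟩ := isCompact_Icc.exists_isMaxOn hne (hfc.mono hsub)
  have hb1 := hb s1 (hsub hs1)
  set Q := (|f s2| + 1) / b s1 with hQ
  have hQ0 : 0 < Q := by positivity
  have hA : 0 < Q ^ (1 / p) := Real.rpow_pos_of_pos hQ0 _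
  refine ⟨Q ^ (1 / p), hA, fun r hr => ?_⟩
  have hzr := hz r hr
  have hbr := hb r hr
  rcases le_or_gt r R0 with h | h
  · have h1 : f r ≤ f s2 := hmax (show r ∈ Icc 0 R0 from ⟨hr.1, h⟩)
    have h2 : b s1 ≤ b r := hmin (show r ∈ Icc 0 R0 from ⟨hr.1, h⟩)
    have h3 : (Q ^ (1 / p)) ^ p = Q := by
      rw [← Real.rpow_mul hQ0.le, one_div_mul_cancel (by linarith), Real.rpow_one]
    calc f r ≤ |f s2| := h1.trans (le_abs_self _)
      _ < |f s2| + 1 := by linarith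
      _ = b s1 * (Q ^ (1 / p)) ^ p := by rw [h3, hQ]; field_simp
      _ ≤ b r * (Q ^ (1 / p) + k * z r) ^ p := by
        have : 0 ≤ k * z r := by positivity
        gcongr
        linarith
  · refine (hnear r ⟨h, hr.2⟩).trans_le ?_
    gcongr
    linarith

end

open Set Filter

section
open Topology

/-- Existence of the explicit strict supersolution. -/
lemma exists_super {n : ℕ} {p R α σ β a1 ε K : ℝ} {a : ℝ → ℝ} (hp : 1 < p) (hR : 0 < R)
    (hσ : 0 ≤ σ) (ha : Continuous a) (hapos : ∀ r, 0 < a r) (ha1 : a R = a1)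
    (hβ : 0 < β) (hβp : β * (p - 1) = 2 + σ) (hβα : 0 < β + 1 - α) (hε : 0 < ε) (hK : 0 < K)
    (hKp : a1 * K ^ (p - 1) = β * (β + 1 - α)) :
    ∃ A > 0, ∃ U' f : ℝ → ℝ,
      (∀ r ∈ Ico 0 R, HasDerivAt
        (fun r => A + (1 + ε) * K * (2 * R) ^ β * (R ^ 2 - r ^ 2) ^ (-β)) (U' r) r) ∧
      ContinuousOn U' (Ico 0 R) ∧ U' 0 = 0 ∧
      (∀ r ∈ Ioo 0 R, HasDerivAt (fun r => r ^ n * (R - r) ^ α * U' r)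
        (r ^ n * (R - r) ^ α * f r) r) ∧ ContinuousOn f (Ico 0 R) ∧
      (∀ r ∈ Ico 0 R, f r < a r * (R - r) ^ σ *
        (A + (1 + ε) * K * (2 * R) ^ β * (R ^ 2 - r ^ 2) ^ (-β)) ^ p) := by
  set k := (1 + ε) * K * (2 * R) ^ β with hk
  have hk0 : 0 < k := by positivity
  have hy : ∀ r ∈ Ico 0 R, 0 < R ^ 2 - r ^ 2 := fun r hr => by nlinarith [hr.1, hr.2]
  have hyc : ∀ q : ℝ, ContinuousOn (fun r : ℝ => (R ^ 2 - r ^ 2) ^ q) (Ico 0 R) := fun q =>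
    (by fun_prop : Continuous fun r : ℝ => R ^ 2 - r ^ 2).continuousOn.rpow_const
      fun r hr => Or.inl (hy r hr).ne'
  set Q : ℝ → ℝ := fun r => 2 * β * (n + 1) * (R ^ 2 - r ^ 2) + 4 * β * (β + 1) * r ^ 2
    - 2 * α * β * r * (R + r) with hQ
  have hQc : Continuous Q := by fun_prop
  set U' : ℝ → ℝ := fun r => k * (2 * β * r * (R ^ 2 - r ^ 2) ^ (-β - 1)) with hU'
  set f : ℝ → ℝ := fun r => k * (Q r * (R ^ 2 - r ^ 2) ^ (-β - 2)) with hf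
  have hfc : ContinuousOn f (Ico 0 R) :=
    continuousOn_const.mul (hQc.continuousOn.mul (hyc _))
  -- behaviour near R
  have hq : Continuous (fun r => a r * (R + |r|) ^ (-σ) * k ^ p - k * Q r) := by
    have : Continuous fun r : ℝ => (R + |r|) ^ (-σ) :=
      (by fun_prop : Continuous fun r : ℝ => R + |r|).rpow_const fun r =>
        Or.inl (by have := abs_nonneg r; positivity)
    fun_prop
  have hqR : 0 < a R * (R + |R|) ^ (-σ) * k ^ p - k * Q R := by
    have h2R : 0 < 2 * R := by linarith
    have e1 : k ^ p = k * k ^ (p - 1) := by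
      rw [mul_comm, ← Real.rpow_add_one hk0.ne']; congr 1; ring
    have e2 : k ^ (p - 1) = (1 + ε) ^ (p - 1) * K ^ (p - 1) * (2 * R) ^ (2 + σ) := by
      rw [hk, Real.mul_rpow (by positivity) (by positivity),
        Real.mul_rpow (by positivity) (by positivity), ← Real.rpow_mul h2R.le, hβp]
    have e3 : (2 * R) ^ (-σ) * (2 * R) ^ (2 + σ) = (2 * R) ^ 2 := by
      rw [← Real.rpow_add h2R, ← Real.rpow_natCast]; congr 1; push_cast; ring
    have e4 : 1 < (1 + ε) ^ (p - 1) := Real.one_lt_rpow (by linarith) (by linarith)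
    have e5 : a R * (R + |R|) ^ (-σ) * k ^ p - k * Q R
        = k * (4 * R ^ 2 * (β * (β + 1 - α))) * ((1 + ε) ^ (p - 1) - 1) := by
      rw [abs_of_pos hR, ← two_mul, e1, e2, ha1]
      have : a1 * (2 * R) ^ (-σ) * (k * ((1 + ε) ^ (p - 1) * K ^ (p - 1) * (2 * R) ^ (2 + σ)))
        = k * (1 + ε) ^ (p - 1) * (a1 * K ^ (p - 1)) * ((2 * R) ^ (-σ) * (2 * R) ^ (2 + σ)) := by
        ring
      rw [this, e3, hKp]
      simp only [hQ]
      ring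
    rw [e5]
    have : 0 < (1 + ε) ^ (p - 1) - 1 := by linarith
    positivity
  obtain ⟨e, he, hball⟩ := Metric.eventually_nhds_iff.1
    (hq.continuousAt.eventually (lt_mem_nhds hqR))
  set R0 := max 0 (R - e) with hR0
  have hR0R : R0 < R := max_lt hR (by linarith)
  obtain ⟨A, hA, hAf⟩ := exists_super_const (b := fun r => a r * (R - r) ^ σ) (f := f)
    (z := fun r => (R ^ 2 - r ^ 2) ^ (-β)) hp hk0 (le_max_left 0 (R - e)) hR0R
    (ha.continuousOn.mul ((by fun_prop : Continuous fun r : ℝ => R - r).continuousOn.rpow_const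
      fun r hr => Or.inr hσ))
    (fun r hr => mul_pos (hapos r) (Real.rpow_pos_of_pos (by linarith [hr.2]) _)) hfc
    (fun r hr => Real.rpow_pos_of_pos (hy r hr) _) (by
      intro r hr
      have hr0 : 0 ≤ r := (le_max_left _ _).trans hr.1.le
      have hre : R - e < r := (le_max_right _ _).trans_lt hr.1
      have hpos := hball (show dist r R < e by
        rw [Real.dist_eq, abs_sub_comm, abs_of_pos (by linarith [hr.2])]; linarith)
      rw [abs_of_nonneg hr0] at hpos
      have hyr := hy r ⟨hr0, hr.2⟩
      have hm : 0 < R - r := by linarith [hr.2]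
      have hpl : 0 < R + r := by linarith
      have e1 : (R - r) ^ σ = (R ^ 2 - r ^ 2) ^ σ * (R + r) ^ (-σ) := by
        have : R ^ 2 - r ^ 2 = (R - r) * (R + r) := by ring
        rw [this, Real.mul_rpow hm.le hpl.le, mul_assoc, ← Real.rpow_add hpl]
        simp
      have e2 : (k * (R ^ 2 - r ^ 2) ^ (-β)) ^ p = k ^ p * (R ^ 2 - r ^ 2) ^ (-β * p) := by
        rw [Real.mul_rpow hk0.le (by positivity), ← Real.rpow_mul hyr.le]
      have e3 : (R ^ 2 - r ^ 2) ^ σ * (R ^ 2 - r ^ 2) ^ (-β * p) = (R ^ 2 - r ^ 2) ^ (-β - 2) := by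
        rw [← Real.rpow_add hyr]; congr 1; linarith
      show k * (Q r * (R ^ 2 - r ^ 2) ^ (-β - 2))
        < a r * (R - r) ^ σ * (k * (R ^ 2 - r ^ 2) ^ (-β)) ^ p
      rw [e1, e2]
      have : a r * ((R ^ 2 - r ^ 2) ^ σ * (R + r) ^ (-σ)) * (k ^ p * (R ^ 2 - r ^ 2) ^ (-β * p))
        = a r * (R + r) ^ (-σ) * k ^ p * ((R ^ 2 - r ^ 2) ^ σ * (R ^ 2 - r ^ 2) ^ (-β * p)) := by
        ring
      rw [this, e3, ← mul_assoc]
      have : 0 < (R ^ 2 - r ^ 2) ^ (-β - 2) := Real.rpow_pos_of_pos hyr _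
      apply mul_lt_mul_of_pos_right _ this
      linarith)
  refine ⟨A, hA, U', f, ?_, ?_, ?_, ?_, hfc, hAf⟩
  · intro r hr
    exact ((deriv_quad hr).const_mul k).const_add A
  · exact continuousOn_const.mul ((by fun_prop : Continuous fun r : ℝ => 2 * β * r).continuousOn.mul
      (hyc _))
  · simp [hU']
  · intro r hr
    have hr' : r ∈ Ico 0 R := ⟨hr.1.le, hr.2⟩
    have hyr := hy r hr'
    have h1 := deriv_quad (β := β + 1) hr'
    have e0 : (fun r : ℝ => (R ^ 2 - r ^ 2) ^ (-(β + 1))) = fun r => (R ^ 2 - r ^ 2) ^ (-β - 1) := by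
      funext r; congr 1; ring
    have e1 : -(β + 1) - 1 = -β - 2 := by ring
    rw [e0, e1] at h1
    have h2 := (((hasDerivAt_id r).const_mul (2 * β)).mul h1).const_mul k
    have h3 := weight_deriv (n := n) (α := α) hr h2
    refine h3.congr_deriv ?_
    congr 1
    have e2 : (R ^ 2 - r ^ 2) ^ (-β - 1) = (R ^ 2 - r ^ 2) ^ (-β - 2) * (R ^ 2 - r ^ 2) := by
      rw [← Real.rpow_add_one hyr.ne']; congr 1; ring
    have hm : R - r ≠ 0 := by linarith [hr.2]
    have hr0 := hr.1.ne'
    simp only [Pi.mul_apply, id, hf, hQ]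
    rw [e2]
    have e3 : R ^ 2 - r ^ 2 = (R - r) * (R + r) := by ring
    generalize (R ^ 2 - r ^ 2) ^ (-β - 2) = Y
    rw [e3]
    field_simp
    ring

/-- Existence of the explicit subsolution near the boundary. -/
lemma exists_sub {n : ℕ} {p R α σ β a1 ε K : ℝ} {a : ℝ → ℝ} (hp : 1 < p) (hR : 0 < R)
    (ha : Continuous a) (hapos : ∀ r, 0 < a r) (ha1 : a R = a1)
    (hβ : 0 < β) (hβp : β * (p - 1) = 2 + σ) (hβα : 0 < β + 1 - α) (hε : ε ∈ Ioo (0 : ℝ) 1)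
    (hK : 0 < K) (hKp : a1 * K ^ (p - 1) = β * (β + 1 - α)) :
    ∃ rv, 0 ≤ rv ∧ rv < R ∧ ∃ v' g : ℝ → ℝ,
      (∀ r < R, HasDerivAt
        (fun r => (1 - ε) * K * ((R - r) ^ (-β) - (R - rv) ^ (-β))) (v' r) r) ∧
      (∀ r ∈ Ioo 0 R, HasDerivAt (fun r => r ^ n * (R - r) ^ α * v' r)
        (r ^ n * (R - r) ^ α * g r) r) ∧
      (∀ r ∈ Ioo rv R, 0 < (1 - ε) * K * ((R - r) ^ (-β) - (R - rv) ^ (-β))) ∧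
      (∀ r ∈ Ioo rv R, a r * (R - r) ^ σ *
        ((1 - ε) * K * ((R - r) ^ (-β) - (R - rv) ^ (-β))) ^ p ≤ g r) := by
  obtain ⟨hε0, hε1⟩ := hε
  have hε2 : 0 < 1 - ε := by linarith
  set k := (1 - ε) * K with hk
  have hk0 : 0 < k := by positivity
  have hqR : a R * k ^ (p - 1) < β * (β + 1 - α) := by
    rw [hk, Real.mul_rpow hε2.le hK.le, ha1, mul_left_comm, hKp]
    have : (1 - ε) ^ (p - 1) < 1 := Real.rpow_lt_one hε2.le (by linarith) (by linarith)
    have h2 : 0 < β * (β + 1 - α) := by positivity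
    nlinarith
  have hq : Continuous fun r => a r * k ^ (p - 1) := by fun_prop
  obtain ⟨e, he, hball⟩ := Metric.eventually_nhds_iff.1
    (hq.continuousAt.eventually (gt_mem_nhds hqR))
  set rv := max 0 (R - e) with hrv
  have hrvR : rv < R := max_lt hR (by linarith)
  have hrv0 : 0 ≤ rv := le_max_left _ _
  have hvpos : ∀ r ∈ Ioo rv R, 0 < k * ((R - r) ^ (-β) - (R - rv) ^ (-β)) := by
    intro r hr
    have : (R - rv) ^ (-β) < (R - r) ^ (-β) :=
      Real.rpow_lt_rpow_of_neg (by linarith [hr.2]) (by linarith [hr.1]) (by linarith)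
    exact mul_pos hk0 (by linarith)
  set v' : ℝ → ℝ := fun r => k * (β * (R - r) ^ (-β - 1)) with hv'
  refine ⟨rv, hrv0, hrvR, v', fun r => k * (β * ((β + 1) * (R - r) ^ (-β - 2)))
    + ((n : ℝ) / r - α / (R - r)) * v' r, ?_, ?_, hvpos, ?_⟩
  · intro r hr
    exact ((deriv_dist hr).sub_const _).const_mul k
  · intro r hr
    have h1 := deriv_dist (β := β + 1) hr.2
    have e0 : (fun r : ℝ => (R - r) ^ (-(β + 1))) = fun r => (R - r) ^ (-β - 1) := by
      funext r; congr 1; ring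
    have e1 : -(β + 1) - 1 = -β - 2 := by ring
    rw [e0, e1] at h1
    exact weight_deriv (n := n) (α := α) hr ((h1.const_mul β).const_mul k)
  · intro r hr
    have hr0 : 0 < r := hrv0.trans_lt hr.1
    have hm : 0 < R - r := by linarith [hr.2]
    have hre : R - e < r := (le_max_right _ _).trans_lt hr.1
    have hlt := hball (show dist r R < e by
        rw [Real.dist_eq, abs_sub_comm, abs_of_pos hm]; linarith)
    have hvle : k * ((R - r) ^ (-β) - (R - rv) ^ (-β)) ≤ k * (R - r) ^ (-β) := by
      have : 0 ≤ (R - rv) ^ (-β) := Real.rpow_nonneg (by linarith) _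
      gcongr
      linarith
    have har := hapos r
    set Y := (R - r) ^ (-β - 2) with hY
    have hY0 : 0 < Y := Real.rpow_pos_of_pos hm _
    have e1 : k ^ p = k * k ^ (p - 1) := by
      rw [mul_comm, ← Real.rpow_add_one hk0.ne']; congr 1; ring
    have e3 : (R - r) ^ σ * (R - r) ^ (-β * p) = Y := by
      rw [← Real.rpow_add hm, hY]; congr 1; linarith
    have e2 : (R - r) ^ (-β - 1) = Y * (R - r) := by
      rw [hY, ← Real.rpow_add_one hm.ne']; congr 1; ring
    calc a r * (R - r) ^ σ * (k * ((R - r) ^ (-β) - (R - rv) ^ (-β))) ^ p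
        ≤ a r * (R - r) ^ σ * (k * (R - r) ^ (-β)) ^ p := by
          have := (hvpos r hr).le
          gcongr
      _ = a r * (R - r) ^ σ * (k ^ p * (R - r) ^ (-β * p)) := by
          rw [Real.mul_rpow hk0.le (by positivity), ← Real.rpow_mul hm.le]
      _ = k * (a r * k ^ (p - 1)) * ((R - r) ^ σ * (R - r) ^ (-β * p)) := by rw [e1]; ring
      _ = k * (a r * k ^ (p - 1)) * Y := by rw [e3]
      _ ≤ k * (β * (β + 1 - α)) * Y := by gcongr
      _ ≤ k * (β * (β + 1 - α)) * Y + (n : ℝ) / r * (k * (β * (Y * (R - r)))) := by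
          have : 0 ≤ (n : ℝ) / r * (k * (β * (Y * (R - r)))) := by positivity
          linarith
      _ = _ := by
          simp only [hv']
          rw [e2]
          field_simp
          ring
end

open Set Filter

section
open Topology

/-- Limits of the two explicit barriers relative to the exact rate. -/
lemma limits_aux {R β A ε K rv : ℝ} (hR : 0 < R) (hβ : 0 < β) (hK : 0 < K) :
    Tendsto (fun r => (1 - ε) * K * ((R - r) ^ (-β) - (R - rv) ^ (-β)) / (K * (R - r) ^ (-β)))
      (𝓝[<] R) (𝓝 (1 - ε)) ∧
    Tendsto (fun r => (A + (1 + ε) * K * (2 * R) ^ β * (R ^ 2 - r ^ 2) ^ (-β)) /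
      (K * (R - r) ^ (-β))) (𝓝[<] R) (𝓝 (1 + ε)) ∧
    Tendsto (fun r : ℝ => (R - r) ^ (-β)) (𝓝[<] R) atTop := by
  have hd : Tendsto (fun r : ℝ => R - r) (𝓝[<] R) (𝓝[>] 0) := by
    apply tendsto_nhdsWithin_iff.2 ⟨?_, ?_⟩
    · have : Tendsto (fun r : ℝ => R - r) (𝓝 R) (𝓝 (R - R)) :=
        (by fun_prop : Continuous fun r : ℝ => R - r).tendsto R
      rw [sub_self] at this
      exact this.mono_left nhdsWithin_le_nhds
    · filter_upwards [self_mem_nhdsWithin] with r hr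
      exact sub_pos.2 (mem_Iio.1 hr)
  have hpow : Tendsto (fun r : ℝ => (R - r) ^ β) (𝓝[<] R) (𝓝 0) := by
    have h := (Real.continuousAt_rpow_const 0 β (Or.inr hβ.le)).tendsto
    rw [Real.zero_rpow hβ.ne'] at h
    exact h.comp (hd.mono_right nhdsWithin_le_nhds)
  have hin : ∀ᶠ r in 𝓝[<] R, r ∈ Ioo 0 R := Ioo_mem_nhdsLT hR
  refine ⟨?_, ?_, ?_⟩
  · have h := (hpow.const_mul ((R - rv) ^ (-β))).const_sub 1 |>.const_mul (1 - ε)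
    rw [mul_zero, sub_zero, mul_one] at h
    refine h.congr' ?_
    filter_upwards [hin] with r hr
    have hm : 0 < R - r := by linarith [hr.2]
    have := Real.rpow_pos_of_pos hm β
    rw [Real.rpow_neg hm.le]
    field_simp
  · have hc : Tendsto (fun r : ℝ => (R + r) ^ (-β)) (𝓝[<] R) (𝓝 ((2 * R) ^ (-β))) := by
      have h := (Real.continuousAt_rpow_const (R + R) (-β) (Or.inl (by linarith))).tendsto
      rw [← two_mul] at h
      refine h.comp ?_
      have : Tendsto (fun r : ℝ => R + r) (𝓝 R) (𝓝 (R + R)) :=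
        (by fun_prop : Continuous fun r : ℝ => R + r).tendsto R
      rw [← two_mul] at this
      exact this.mono_left nhdsWithin_le_nhds
    have h := (hpow.const_mul (A / K)).add (hc.const_mul ((1 + ε) * (2 * R) ^ β))
    have e : A / K * 0 + (1 + ε) * (2 * R) ^ β * (2 * R) ^ (-β) = 1 + ε := by
      rw [mul_assoc, ← Real.rpow_add (by linarith)]; simp
    rw [e] at h
    refine h.congr' ?_
    filter_upwards [hin] with r hr
    have hm : 0 < R - r := by linarith [hr.2]
    have hpl : 0 < R + r := by linarith [hr.1]
    have := Real.rpow_pos_of_pos hm β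
    have e2 : R ^ 2 - r ^ 2 = (R - r) * (R + r) := by ring
    rw [e2, Real.mul_rpow hm.le hpl.le, Real.rpow_neg hm.le]
    field_simp
  · exact (tendsto_rpow_neg_nhdsGT_zero (neg_lt_zero.2 hβ)).comp hd
end

theorem exists_large_solution_radial_ODE
    (N : ℕ) (hN : 1 ≤ N) (p R α γ : ℝ) (hp : 1 < p) (hR : 0 < R) (hγα : 0 ≤ γ - α)
    (a : ℝ → ℝ) (ha_cont : ContinuousOn a (Icc 0 R)) (ha_pos : ∀ r ∈ Icc 0 R, 0 < a r)
    (β : ℝ) (hβ : β = (2 + γ - α) / (p - 1)) (hβα : 0 < β + 1 - α)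
    (hβα2 : (3 + (N : ℝ)) * β ≥ 2 * α)
    (K : ℝ) (hK : K = (β * (β + 1 - α) / a R) ^ (1 / (p - 1))) :
    ∀ ε ∈ Ioo (0 : ℝ) 1, ∃ ψ ψ' : ℝ → ℝ,
      (∀ r ∈ Ioo 0 R, 0 < ψ r) ∧
      (∀ r ∈ Ioo 0 R, HasDerivAt ψ (ψ' r) r) ∧
      HasDerivWithinAt ψ (ψ' 0) (Ici 0) 0 ∧
      ContinuousOn ψ' (Ico 0 R) ∧
      ψ' 0 = 0 ∧
      (∀ r ∈ Ioo 0 R, DifferentiableAt ℝ ψ' r) ∧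
      (∀ r ∈ Ioo 0 R,
        deriv ψ' r + (((N : ℝ) - 1) / r - α / (R - r)) * ψ' r
          = a r * (R - r) ^ (γ - α) * ψ r ^ p) ∧
      Tendsto ψ (nhdsWithin R (Iio R)) atTop ∧
      1 - ε ≤ liminf (fun r => ψ r / (K * (R - r) ^ (-β))) (nhdsWithin R (Iio R)) ∧
      limsup (fun r => ψ r / (K * (R - r) ^ (-β))) (nhdsWithin R (Iio R)) ≤ 1 + ε := by
  intro ε hε
  obtain ⟨n, rfl⟩ : ∃ n, N = n + 1 := ⟨N - 1, by omega⟩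
  have hp1 : 0 < p - 1 := by linarith
  have hβ0 : 0 < β := by rw [hβ]; apply div_pos <;> linarith
  have hβp : β * (p - 1) = 2 + (γ - α) := by rw [hβ]; field_simp; ring
  have haR : 0 < a R := ha_pos R ⟨hR.le, le_rfl⟩
  have hKb : 0 < β * (β + 1 - α) / a R := by positivity
  have hK0 : 0 < K := by rw [hK]; exact Real.rpow_pos_of_pos hKb _
  have hKp : a R * K ^ (p - 1) = β * (β + 1 - α) := by
    rw [hK, ← Real.rpow_mul hKb.le, one_div, inv_mul_cancel₀ hp1.ne', Real.rpow_one]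
    field_simp
  set a2 : ℝ → ℝ := IccExtend hR.le ((Icc 0 R).domRestrict a) with ha2
  have ha2c : Continuous a2 := (continuousOn_iff_continuous_domRestrict.1 ha_cont).Icc_extend'
  have ha2e : ∀ r ∈ Icc 0 R, a2 r = a r := fun r hr => by
    rw [ha2, IccExtend_of_mem hR.le _ hr]; rfl
  have ha2p : ∀ r, 0 < a2 r := fun r => by
    simp only [ha2, IccExtend, Function.comp]
    exact ha_pos _ (Subtype.prop _)
  have ha2R : a2 R = a R := ha2e R ⟨hR.le, le_rfl⟩
  obtain ⟨A, hA, U', f, hUd, hU'c, hU'0, hUf, hfc, hf⟩ := exists_super (n := n) hp hR hγα ha2c ha2p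
    ha2R hβ0 hβp hβα hε.1 hK0 hKp
  obtain ⟨rv, hrv0, hrvR, v', g, hvd, hvw, hvpos, hg⟩ := exists_sub (n := n) hp hR ha2c ha2p
    ha2R hβ0 hβp hβα hε hK0 hKp
  have hmc : ∀ q : ℝ, ContinuousOn (fun r : ℝ => (R - r) ^ q) (Ico 0 R) := fun q =>
    (by fun_prop : Continuous fun r : ℝ => R - r).continuousOn.rpow_const
      fun r hr => Or.inl (by have := hr.2; intro h; linarith)
  have hwc : ContinuousOn (fun r : ℝ => r ^ n * (R - r) ^ α) (Ico 0 R) :=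
    (continuous_pow n).continuousOn.mul (hmc α)
  have hwpos : ∀ r ∈ Ioo 0 R, 0 < r ^ n * (R - r) ^ α := fun r hr =>
    mul_pos (pow_pos hr.1 n) (Real.rpow_pos_of_pos (by linarith [hr.2]) α)
  have hvU : ∀ r ∈ Ioo rv R, (1 - ε) * K * ((R - r) ^ (-β) - (R - rv) ^ (-β))
      ≤ A + (1 + ε) * K * (2 * R) ^ β * (R ^ 2 - r ^ 2) ^ (-β) := by
    intro r hr
    have hr0 : 0 < r := hrv0.trans_lt hr.1
    have hm : 0 < R - r := by linarith [hr.2]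
    have hpl : 0 < R + r := by linarith
    have e2 : R ^ 2 - r ^ 2 = (R - r) * (R + r) := by ring
    have h1 : 1 ≤ (2 * R) ^ β * (R + r) ^ (-β) := by
      have : (2 * R) ^ β * (2 * R) ^ (-β) = 1 := by
        rw [← Real.rpow_add (by linarith)]; simp
      rw [← this]
      apply mul_le_mul_of_nonneg_left _ (by positivity)
      exact Real.rpow_le_rpow_of_nonpos hpl (by linarith [hr.2]) (by linarith)
    have h2 : 0 ≤ (R - rv) ^ (-β) := Real.rpow_nonneg (by linarith) _
    have h3 : 0 < (R - r) ^ (-β) := Real.rpow_pos_of_pos hm _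
    have hε1 := hε.1
    have hε2 : 0 < 1 - ε := by linarith [hε.2]
    calc (1 - ε) * K * ((R - r) ^ (-β) - (R - rv) ^ (-β))
        ≤ (1 - ε) * K * (R - r) ^ (-β) := by gcongr; linarith
      _ ≤ (1 + ε) * K * (R - r) ^ (-β) := by gcongr; linarith
      _ ≤ (1 + ε) * K * (R - r) ^ (-β) * ((2 * R) ^ β * (R + r) ^ (-β)) :=
          le_mul_of_one_le_right (by positivity) h1
      _ = (1 + ε) * K * (2 * R) ^ β * (R ^ 2 - r ^ 2) ^ (-β) := by
          rw [e2, Real.mul_rpow hm.le hpl.le]; ring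
      _ ≤ _ := by linarith
  obtain ⟨x, Φ, hx0, hxc, hΦc, hΦ0, hxd, hΦd, hΦM, hxU, hvx⟩ :=
    abstract_existence (w := fun r => r ^ n * (R - r) ^ α)
      (b := fun r => a2 r * (R - r) ^ (γ - α))
      (U := fun r => A + (1 + ε) * K * (2 * R) ^ β * (R ^ 2 - r ^ 2) ^ (-β))
      (U' := U') (f := f)
      (v := fun r => (1 - ε) * K * ((R - r) ^ (-β) - (R - rv) ^ (-β)))
      (v' := v') (g := g) (rv := rv) hp hR
      (by fun_prop) (ha2c.measurable.mul (by fun_prop)) hwpos hwc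
      (ha2c.continuousOn.mul (hmc _))
      (fun r hr => mul_pos (ha2p r) (Real.rpow_pos_of_pos (by linarith [hr.2]) _))
      (fun ρ hρ => weight_bound ρ hρ)
      (fun r hr => by
        have : 0 < R ^ 2 - r ^ 2 := by nlinarith [hr.1, hr.2]
        have := hε.1
        positivity)
      (fun r hr => (hUd r hr).continuousAt.continuousWithinAt)
      (fun r hr => hUd r ⟨hr.1.le, hr.2⟩)
      (hwc.mul hU'c) (by simp [hU'0]) hUf hfc hf hrv0 hrvR
      (fun r hr => (hvd r hr.2).continuousAt.continuousWithinAt)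
      (fun r hr => hvd r hr.2)
      (fun r hr => hvw r ⟨hrv0.trans_lt hr.1, hr.2⟩)
      (by simp) hvpos hg hvU
  set ψ' : ℝ → ℝ := fun r => if r = 0 then 0 else Φ r / (r ^ n * (R - r) ^ α) with hψ'
  have hψ0 : ψ' 0 = 0 := by simp [hψ']
  have hψe : ∀ r ∈ Ioo 0 R, ψ' r = Φ r / (r ^ n * (R - r) ^ α) := fun r hr => by
    simp [hψ', hr.1.ne']
  have hψev : ∀ r ∈ Ioo 0 R, ψ' =ᶠ[nhds r] fun r => Φ r / (r ^ n * (R - r) ^ α) := fun r hr => by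
    filter_upwards [Ioo_mem_nhds hr.1 hr.2] with s hs using hψe s hs
  have hψd : ∀ r ∈ Ioo 0 R, HasDerivAt ψ' (a r * (R - r) ^ (γ - α) * x r ^ p
      - ((n : ℝ) / r - α / (R - r)) * ψ' r) r := by
    intro r hr
    have hw := weight_deriv (n := n) (α := α) hr (hasDerivAt_const r (1 : ℝ))
    simp only [mul_one, zero_add] at hw
    have hwr := hwpos r hr
    have h := (hΦd r hr).div hw hwr.ne'
    refine (h.congr_of_eventuallyEq (hψev r hr)).congr_deriv ?_
    rw [hψe r hr, ha2e r ⟨hr.1.le, hr.2.le⟩]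
    generalize (n : ℝ) / r - α / (R - r) = q
    generalize r ^ n * (R - r) ^ α = W at hwr
    generalize (R - r) ^ (γ - α) = Z
    field_simp
  have hxd' : ∀ r ∈ Ioo 0 R, HasDerivAt x (ψ' r) r := fun r hr => by
    rw [hψe r hr]; exact hxd r hr
  have hlim0 : Tendsto ψ' (nhdsWithin 0 (Ioi 0)) (nhds 0) := by
    obtain ⟨M, hM⟩ := hΦM (R / 2) ⟨by linarith, by linarith⟩
    have hMs : Tendsto (fun s : ℝ => M * s) (nhdsWithin 0 (Ioi 0)) (nhds 0) := by
      have : Tendsto (fun s : ℝ => M * s) (nhds 0) (nhds (M * 0)) :=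
        (by fun_prop : Continuous fun s : ℝ => M * s).tendsto 0
      rw [mul_zero] at this
      exact this.mono_left nhdsWithin_le_nhds
    refine tendsto_of_tendsto_of_tendsto_of_le_of_le' tendsto_const_nhds hMs ?_ ?_
    · filter_upwards [Ioo_mem_nhdsGT hR] with s hs
      rw [hψe s hs]
      exact div_nonneg (hΦ0 s ⟨hs.1.le, hs.2⟩) (hwpos s hs).le
    · filter_upwards [Ioo_mem_nhdsGT (show (0:ℝ) < R / 2 by linarith)] with s hs
      have hs' : s ∈ Ioo 0 R := ⟨hs.1, by linarith [hs.2]⟩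
      rw [hψe s hs', div_le_iff₀ (hwpos s hs')]
      exact hM s ⟨hs.1, hs.2.le⟩
  have hin : ∀ᶠ r in nhdsWithin R (Iio R), r ∈ Ioo rv R := Ioo_mem_nhdsLT hrvR
  obtain ⟨l1, l2, l3⟩ := limits_aux (A := A) (ε := ε) (rv := rv) hR hβ0 hK0
  have hrate : ∀ r ∈ Ioo rv R, 0 < K * (R - r) ^ (-β) := fun r hr =>
    mul_pos hK0 (Real.rpow_pos_of_pos (by linarith [hr.2]) _)
  have hlow : (fun r => (1 - ε) * K * ((R - r) ^ (-β) - (R - rv) ^ (-β)) / (K * (R - r) ^ (-β)))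
      ≤ᶠ[nhdsWithin R (Iio R)] fun r => x r / (K * (R - r) ^ (-β)) := by
    filter_upwards [hin] with r hr
    exact div_le_div_of_nonneg_right (hvx r hr) (hrate r hr).le
  have hupp : (fun r => x r / (K * (R - r) ^ (-β))) ≤ᶠ[nhdsWithin R (Iio R)]
      fun r => (A + (1 + ε) * K * (2 * R) ^ β * (R ^ 2 - r ^ 2) ^ (-β)) /
        (K * (R - r) ^ (-β)) := by
    filter_upwards [hin] with r hr
    exact div_le_div_of_nonneg_right (hxU r ⟨hrv0.trans hr.1.le, hr.2⟩) (hrate r hr).le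
  have hbU : IsBoundedUnder (· ≤ ·) (nhdsWithin R (Iio R)) fun r => x r / (K * (R - r) ^ (-β)) :=
    l2.isBoundedUnder_le.mono_le hupp
  have hbL : IsBoundedUnder (· ≥ ·) (nhdsWithin R (Iio R)) fun r => x r / (K * (R - r) ^ (-β)) :=
    l1.isBoundedUnder_ge.mono_ge hlow
  refine ⟨x, ψ', fun r hr => hx0 r ⟨hr.1.le, hr.2⟩, hxd', ?_, ?_, hψ0,
    fun r hr => (hψd r hr).differentiableAt, ?_, ?_, ?_, ?_⟩
  · rw [hψ0]
    refine hasDerivWithinAt_Ici_of_tendsto_deriv (s := Ioo 0 R)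
      (fun r hr => (hxd' r hr).differentiableAt.differentiableWithinAt)
      ((hxc 0 ⟨le_rfl, hR⟩).mono Ioo_subset_Ico_self) (Ioo_mem_nhdsGT hR) ?_
    refine hlim0.congr' ?_
    filter_upwards [Ioo_mem_nhdsGT hR] with s hs using (hxd' s hs).deriv.symm
  · intro r hr
    rcases hr.1.eq_or_lt with h | h
    · subst h
      have h1 : ContinuousWithinAt ψ' (Ioi 0) 0 := by
        rw [ContinuousWithinAt, hψ0]; exact hlim0
      exact (continuousWithinAt_Ioi_iff_Ici.1 h1).mono Ico_subset_Ici_self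
    · exact (hψd r ⟨h, hr.2⟩).continuousAt.continuousWithinAt
  · intro r hr
    rw [(hψd r hr).deriv]
    push_cast
    ring
  · have h1 : Tendsto (fun r : ℝ => (1 - ε) * K * ((R - r) ^ (-β) - (R - rv) ^ (-β)))
        (nhdsWithin R (Iio R)) atTop :=
      (tendsto_atTop_add_const_right _ (-(R - rv) ^ (-β)) l3).const_mul_atTop
        (mul_pos (by linarith [hε.2]) hK0)
    refine tendsto_atTop_mono' _ ?_ h1
    filter_upwards [hin] with r hr using hvx r hr
  · rw [← l1.liminf_eq]
    exact liminf_le_liminf hlow l1.isBoundedUnder_ge hbU.isCoboundedUnder_ge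
  · rw [← l2.limsup_eq]
    exact limsup_le_limsup hupp hbL.isCoboundedUnder_le l2.isBoundedUnder_le
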